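/- arXiv:1007.5265 — 2 statements merged into one kernel-verified Lean document; each statement's English description precedes it below -/
import Mathlib

section
/- Let R be an integral domain and * a star operation on R that is spectral and of finite type (i.e. * is of finite type and (I ∩ J)^* = I^* ∩ J^* for all fractional ideals I, J). Then the following are equivalent: (i) R is integrally closed and *-stable (every nonzero ideal of R is *-stable); (ii) R is a Prüfer *-multiplication domain ((J(R : J))^* = R for every nonzero finitely generated ideal J), R is strongly *-discrete ((P²)^* ≠ P for every nonzero prime ideal P of R with P^* = P), and R has *-finite character (every nonzero element of R lies in only finitely many *-maximal ideals). -/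
open scoped Pointwise

section Defs

variable (A K : Type*) [CommRing A] [Field K] [Algebra A K]

/-- `I` is a nonzero fractional ideal of `A` (inside `K`):
`I ≠ 0` and `dI ⊆ A` for some nonzero `d ∈ A`. -/
def IsFrac (I : Submodule A K) : Prop :=
  I ≠ ⊥ ∧ ∃ d : A, d ≠ 0 ∧ ∀ x ∈ I, ∃ a : A, algebraMap A K d * x = algebraMap A K a

/-- The divisorial closure `I^v = (A : (A : I))`; here `(J : I) = J / I` and
`(1 : Submodule A K)` is the image of `A` in `K`. -/
def vS (I : Submodule A K) : Submodule A K := 1 / (1 / I)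

/-- The `t`-operation `I^t = ⋃ {J^v : J ⊆ I nonzero finitely generated}` (a directed union,
hence equal to the supremum of submodules). -/
def tS (I : Submodule A K) : Submodule A K :=
  ⨆ J ∈ {J : Submodule A K | J ≠ ⊥ ∧ J.FG ∧ J ≤ I}, vS A K J

/-- The image of an integral ideal of `A` in `K`. -/
def idealK (I : Ideal A) : Submodule A K := Submodule.map (Algebra.linearMap A K) I

/-- A nonzero (fractional) ideal `I` is stable if `I((I:I):I) = (I:I)`. -/
def IsStableIdeal (I : Submodule A K) : Prop := I * ((I / I) / I) = I / I

/-- `A` is a stable domain: every nonzero (fractional) ideal is stable. -/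
def StableDomain : Prop := ∀ I : Submodule A K, IsFrac A K I → IsStableIdeal A K I

/-- `A` is Clifford regular: every nonzero (fractional) ideal `I` satisfies `I = I²J`
for some nonzero `A`-submodule `J` of `K`. -/
def CliffordRegularDomain : Prop :=
  ∀ I : Submodule A K, IsFrac A K I → ∃ J : Submodule A K, J ≠ ⊥ ∧ I = I * I * J

end Defs
section Star

variable (R K : Type*) [CommRing R] [IsDomain R] [Field K] [Algebra R K] [IsFractionRing R K]

/-- A star operation on the domain `R` with quotient field `K`: a map on (nonzero)
fractional ideals satisfying `(aI)^* = aI^*`, `R^* = R`, `I ⊆ I^*`, monotonicity and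
idempotency. -/
structure StarOperation : Type _ where
  star : Submodule R K → Submodule R K
  star_frac : ∀ I, IsFrac R K I → IsFrac R K (star I)
  star_smul : ∀ (a : K), a ≠ 0 → ∀ I, IsFrac R K I → star (a • I) = a • star I
  star_one : star (1 : Submodule R K) = 1
  le_star : ∀ I, IsFrac R K I → I ≤ star I
  star_mono : ∀ I J, IsFrac R K I → IsFrac R K J → I ≤ J → star I ≤ star J
  star_star : ∀ I, IsFrac R K I → star (star I) = star I

variable {R K}

/-- `*` is of finite type: `I^* = ⋃ {J^* : J ⊆ I nonzero finitely generated}`. -/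
def StarOperation.FiniteType (s : StarOperation R K) : Prop :=
  ∀ I, IsFrac R K I →
    s.star I = ⨆ J ∈ {J : Submodule R K | J ≠ ⊥ ∧ J.FG ∧ J ≤ I}, s.star J

/-- `I` is `*`-stable: with `E := (I^* : I^*)`, one has `(I^*(E : I^*))^* = E`. -/
def StarOperation.Stable (s : StarOperation R K) (I : Submodule R K) : Prop :=
  s.star (s.star I * ((s.star I / s.star I) / s.star I)) = s.star I / s.star I

/-- `I` is Clifford `*`-regular: `I^* = (I²J)^*` for some nonzero ideal `J`. -/
def StarOperation.Regular (s : StarOperation R K) (I : Submodule R K) : Prop :=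
  ∃ J : Submodule R K, IsFrac R K J ∧ s.star I = s.star (I * I * J)

/-- `I` is Boole `*`-regular: `(I²)^* = xI^*` for some nonzero `x ∈ K`. -/
def StarOperation.BooleRegular (s : StarOperation R K) (I : Submodule R K) : Prop :=
  ∃ x : K, x ≠ 0 ∧ s.star (I * I) = x • s.star I

/-- `I` is strongly `*`-stable: `I^* = xE` for some nonzero `x ∈ K`, where `E = (I^* : I^*)`. -/
def StarOperation.StronglyStable (s : StarOperation R K) (I : Submodule R K) : Prop :=
  ∃ x : K, x ≠ 0 ∧ s.star I = x • (s.star I / s.star I)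

end Star

/-- `M` is a `*`-maximal ideal of `R`: an integral `*`-ideal maximal among proper integral
`*`-ideals. -/
def StarOperation.MaxIdeal {R K : Type*} [CommRing R] [IsDomain R] [Field K] [Algebra R K]
    [IsFractionRing R K] (s : StarOperation R K) (M : Ideal R) : Prop :=
  M ≠ ⊤ ∧ s.star (idealK R K M) = idealK R K M ∧
    ∀ J : Ideal R, J ≠ ⊤ → s.star (idealK R K J) = idealK R K J → M ≤ J → J = M

set_option linter.unusedSectionVars false

section Frac

variable {R K : Type*} [CommRing R] [IsDomain R] [Field K] [Algebra R K] [IsFractionRing R K]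

theorem IsFrac.of_le {I J : Submodule R K} (hI : IsFrac R K I) (hJ : J ≠ ⊥) (h : J ≤ I) :
    IsFrac R K J :=
  ⟨hJ, hI.2.imp fun _ hd => ⟨hd.1, fun x hx => hd.2 x (h hx)⟩⟩

theorem IsFrac.one : IsFrac R K (1 : Submodule R K) := by
  refine ⟨one_ne_zero, 1, one_ne_zero, fun x hx => ?_⟩
  obtain ⟨a, rfl⟩ := Submodule.mem_one.1 hx
  exact ⟨a, by simp⟩

theorem IsFrac.exists_mem_ne_zero {I : Submodule R K} (hI : IsFrac R K I) : ∃ x ∈ I, x ≠ 0 :=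
  Submodule.exists_mem_ne_zero_of_ne_bot hI.1

theorem IsFrac.smul {I : Submodule R K} (hI : IsFrac R K I) {a : K} (ha : a ≠ 0) :
    IsFrac R K (a • I) := by
  obtain ⟨x, hx, hx0⟩ := hI.exists_mem_ne_zero
  obtain ⟨d, hd, h⟩ := hI.2
  refine ⟨fun h => mul_ne_zero ha hx0 ?_, ?_⟩
  · have := Submodule.smul_mem_pointwise_smul x a I hx
    rw [h] at this
    simpa using this
  obtain ⟨n, m, hm, rfl⟩ := IsFractionRing.div_surjective (A := R) a
  have hm0 : algebraMap R K m ≠ 0 := IsFractionRing.to_map_ne_zero_of_mem_nonZeroDivisors hm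
  refine ⟨d * m, mul_ne_zero hd (nonZeroDivisors.ne_zero hm), fun y hy => ?_⟩
  obtain ⟨z, hz, rfl⟩ := (Submodule.mem_smul_pointwise_iff_exists _ _ _).1 hy
  obtain ⟨b, hb⟩ := h z hz
  refine ⟨n * b, ?_⟩
  rw [map_mul, map_mul, ← hb, smul_eq_mul]
  field_simp

theorem IsFrac.mul {I J : Submodule R K} (hI : IsFrac R K I) (hJ : IsFrac R K J) :
    IsFrac R K (I * J) := by
  obtain ⟨x, hx, hx0⟩ := hI.exists_mem_ne_zero
  obtain ⟨y, hy, hy0⟩ := hJ.exists_mem_ne_zero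
  obtain ⟨d, hd, h⟩ := hI.2
  obtain ⟨e, he, h'⟩ := hJ.2
  refine ⟨(Submodule.ne_bot_iff _).2 ⟨x * y, Submodule.mul_mem_mul hx hy, mul_ne_zero hx0 hy0⟩,
    d * e, mul_ne_zero hd he, fun z hz => ?_⟩
  refine Submodule.mul_induction_on hz (fun m hm n hn => ?_) fun m n hm hn => ?_
  ·
    obtain ⟨a, ha⟩ := h m hm
    obtain ⟨b, hb⟩ := h' n hn
    exact ⟨a * b, by rw [map_mul, map_mul, ← ha, ← hb]; ring⟩
  ·
    obtain ⟨a, ha⟩ := hm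
    obtain ⟨b, hb⟩ := hn
    exact ⟨a + b, by rw [map_add, mul_add, ha, hb]⟩

theorem IsFrac.inf {I J : Submodule R K} (hI : IsFrac R K I) (hJ : IsFrac R K J) :
    IsFrac R K (I ⊓ J) := by
  obtain ⟨x, hx, hx0⟩ := hI.exists_mem_ne_zero
  obtain ⟨y, hy, hy0⟩ := hJ.exists_mem_ne_zero
  obtain ⟨d, hd, h⟩ := hI.2
  obtain ⟨e, he, h'⟩ := hJ.2
  obtain ⟨a, ha⟩ := h x hx
  obtain ⟨b, hb⟩ := h' y hy
  have hd0 : algebraMap R K d ≠ 0 := by simpa using hd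
  have he0 : algebraMap R K e ≠ 0 := by simpa using he
  refine hI.of_le ((Submodule.ne_bot_iff _).2 ⟨algebraMap R K d * x * (algebraMap R K e * y),
    ⟨?_, ?_⟩, by positivity⟩) inf_le_left
  · rw [hb, mul_right_comm, ← map_mul, ← Algebra.smul_def]
    exact I.smul_mem _ hx
  · rw [ha, ← mul_assoc, ← map_mul, ← Algebra.smul_def]
    exact J.smul_mem _ hy

theorem IsFrac.div {I J : Submodule R K} (hI : IsFrac R K I) (hJ : IsFrac R K J) :
    IsFrac R K (I / J) := by
  obtain ⟨x, hx, hx0⟩ := hI.exists_mem_ne_zero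
  obtain ⟨y, hy, hy0⟩ := hJ.exists_mem_ne_zero
  obtain ⟨e, he, h'⟩ := hJ.2
  have he0 : algebraMap R K e ≠ 0 := by simpa using he
  refine (hI.smul (inv_ne_zero hy0)).of_le ((Submodule.ne_bot_iff _).2
    ⟨algebraMap R K e * x, Submodule.mem_div_iff_forall_mul_mem.2 fun z hz => ?_,
      mul_ne_zero he0 hx0⟩) fun z hz => ?_
  · obtain ⟨b, hb⟩ := h' z hz
    rw [mul_right_comm, hb, ← Algebra.smul_def]
    exact I.smul_mem _ hx
  · refine (Submodule.mem_smul_pointwise_iff_exists _ _ _).2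
      ⟨z * y, Submodule.mem_div_iff_forall_mul_mem.1 hz y hy, ?_⟩
    rw [smul_eq_mul]
    field_simp

theorem mem_idealK_iff {I : Ideal R} {x : K} : x ∈ idealK R K I ↔ ∃ r ∈ I, algebraMap R K r = x :=
  Submodule.mem_map

theorem algebraMap_mem_idealK {I : Ideal R} {r : R} : algebraMap R K r ∈ idealK R K I ↔ r ∈ I := by
  rw [mem_idealK_iff]
  exact ⟨fun ⟨_, h, e⟩ => IsFractionRing.injective R K e ▸ h, fun h => ⟨r, h, rfl⟩⟩

theorem algebraMap_mem_one (r : R) : algebraMap R K r ∈ (1 : Submodule R K) :=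
  Submodule.mem_one.2 ⟨r, rfl⟩

theorem idealK_le_one (I : Ideal R) : idealK R K I ≤ 1 := fun x hx => by
  obtain ⟨r, -, rfl⟩ := mem_idealK_iff.1 hx
  exact algebraMap_mem_one r

theorem IsFrac.idealK {I : Ideal R} (hI : I ≠ ⊥) : IsFrac R K (idealK R K I) := by
  obtain ⟨r, hr, hr0⟩ := Submodule.exists_mem_ne_zero_of_ne_bot hI
  exact IsFrac.one.of_le ((Submodule.ne_bot_iff _).2
    ⟨algebraMap R K r, algebraMap_mem_idealK.2 hr, by simpa using hr0⟩) (idealK_le_one I)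

theorem exists_idealK_eq {J : Submodule R K} (hJ : J ≤ 1) : ∃ I : Ideal R, idealK R K I = J := by
  refine ⟨J.comap (Algebra.linearMap R K), Submodule.map_comap_eq_self ?_⟩
  rwa [← Submodule.one_eq_range]

theorem idealK_le_idealK {I J : Ideal R} : idealK R K I ≤ idealK R K J ↔ I ≤ J :=
  Submodule.map_le_map_iff_of_injective (IsFractionRing.injective R K) I J

theorem IsFrac.of_fg {J : Submodule R K} (hJ : J ≠ ⊥) (hfg : J.FG) : IsFrac R K J := by
  obtain ⟨d, hd, h⟩ := FractionalIdeal.isFractional_of_fg (S := nonZeroDivisors R) hfg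
  refine ⟨hJ, d, nonZeroDivisors.ne_zero hd, fun x hx => ?_⟩
  obtain ⟨a, ha⟩ := h x hx
  exact ⟨a, by rw [ha, Algebra.smul_def]⟩

end Frac

section StarOperation

variable {R K : Type*} [CommRing R] [IsDomain R] [Field K] [Algebra R K] [IsFractionRing R K]
  {s : StarOperation R K}

namespace StarOperation

/-- `*` is spectral: it distributes over finite intersections of fractional ideals. -/
def Spectral (s : StarOperation R K) : Prop :=
  ∀ I J : Submodule R K, IsFrac R K I → IsFrac R K J → s.star (I ⊓ J) = s.star I ⊓ s.star J

theorem FiniteType.exists_fg (hft : s.FiniteType) {I : Submodule R K} (hI : IsFrac R K I) {x : K}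
    (hx : x ∈ s.star I) : ∃ J : Submodule R K, J ≠ ⊥ ∧ J.FG ∧ J ≤ I ∧ x ∈ s.star J := by
  rw [hft I hI] at hx
  obtain ⟨y, hy, hy0⟩ := hI.exists_mem_ne_zero
  have hy' : R ∙ y ∈ {J : Submodule R K | J ≠ ⊥ ∧ J.FG ∧ J ≤ I} :=
    ⟨by simpa using hy0, Submodule.fg_span_singleton y, by simpa using hy⟩
  have : Nonempty {J : Submodule R K | J ≠ ⊥ ∧ J.FG ∧ J ≤ I} := ⟨⟨_, hy'⟩⟩
  rw [iSup_subtype', Submodule.mem_iSup_of_directed] at hx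
  · obtain ⟨⟨J, h0, hfg, hle⟩, hxJ⟩ := hx
    exact ⟨J, h0, hfg, hle, hxJ⟩
  · rintro ⟨J, h0, hfg, hle⟩ ⟨J', h0', hfg', hle'⟩
    have h : J ⊔ J' ≠ ⊥ := fun h => h0 (le_bot_iff.1 (h ▸ le_sup_left))
    have hfr := IsFrac.of_fg h (hfg.sup hfg')
    exact ⟨⟨J ⊔ J', h, hfg.sup hfg', sup_le hle hle'⟩,
      s.star_mono _ _ (hfr.of_le h0 le_sup_left) hfr le_sup_left,
      s.star_mono _ _ (hfr.of_le h0' le_sup_right) hfr le_sup_right⟩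

theorem isFrac_inv_smul_inf_one {I : Submodule R K} (hI : IsFrac R K I) {x : K} (hx : x ≠ 0) :
    IsFrac R K (x⁻¹ • I ⊓ 1) :=
  (hI.smul (inv_ne_zero hx)).inf IsFrac.one

theorem star_inv_smul_inf_one
    (hinter : s.Spectral) {I : Submodule R K} (hI : IsFrac R K I) {x : K} (hx : x ≠ 0) :
    s.star (x⁻¹ • I ⊓ 1) = x⁻¹ • s.star I ⊓ 1 := by
  rw [hinter _ _ (hI.smul (inv_ne_zero hx)) IsFrac.one, s.star_smul _ (inv_ne_zero hx) _ hI,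
    s.star_one]

theorem mem_inv_smul_iff {I : Submodule R K} {x y : K} (hx : x ≠ 0) :
    y ∈ x⁻¹ • I ↔ x * y ∈ I := by
  rw [Submodule.mem_smul_pointwise_iff_exists]
  constructor
  · rintro ⟨z, hz, rfl⟩
    rwa [smul_eq_mul, mul_inv_cancel_left₀ hx]
  · exact fun h => ⟨_, h, by rw [smul_eq_mul, inv_mul_cancel_left₀ hx]⟩

theorem exists_notMem_smul_mem
    (hinter : s.Spectral) {I : Submodule R K} (hI : IsFrac R K I) {x : K} (hx : x ∈ s.star I)
    {M : Ideal R} (hM : M ≠ ⊤) (hM0 : M ≠ ⊥) (hMs : s.star (idealK R K M) = idealK R K M) :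
    ∃ r ∉ M, r • x ∈ I := by
  rcases eq_or_ne x 0 with rfl | hx0
  · exact ⟨1, (Ideal.ne_top_iff_one M).1 hM, by simp⟩
  by_contra! h
  have hle : x⁻¹ • I ⊓ 1 ≤ idealK R K M := by
    rintro y ⟨hy, hy1⟩
    obtain ⟨r, rfl⟩ := Submodule.mem_one.1 hy1
    rw [SetLike.mem_coe, mem_inv_smul_iff hx0] at hy
    by_contra hr
    rw [algebraMap_mem_idealK] at hr
    exact h r hr (by rwa [Algebra.smul_def, mul_comm])
  have h1 := s.star_mono _ _ (isFrac_inv_smul_inf_one hI hx0) (IsFrac.idealK hM0) hle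
  rw [star_inv_smul_inf_one hinter hI hx0, hMs] at h1
  refine (Ideal.ne_top_iff_one M).1 hM (algebraMap_mem_idealK.1 (h1 ⟨?_, algebraMap_mem_one 1⟩))
  rw [SetLike.mem_coe, mem_inv_smul_iff hx0]
  simpa using hx

theorem exists_maxIdeal_le (hft : s.FiniteType) {A : Ideal R} (hA : A ≠ ⊤) (hA0 : A ≠ ⊥)
    (hAs : s.star (idealK R K A) = idealK R K A) : ∃ M, s.MaxIdeal M ∧ A ≤ M := by
  have hub : ∀ c ⊆ {J : Ideal R | J ≠ ⊤ ∧ s.star (idealK R K J) = idealK R K J ∧ A ≤ J},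
      IsChain (· ≤ ·) c → ∀ y ∈ c, ∃ ub ∈ {J : Ideal R | J ≠ ⊤ ∧
        s.star (idealK R K J) = idealK R K J ∧ A ≤ J}, ∀ z ∈ c, z ≤ ub := by
    intro c hc hchain y hy
    have hdir : DirectedOn (· ≤ ·) c := hchain.directedOn
    have hy0 : y ≠ ⊥ := fun h => hA0 (le_bot_iff.1 (h ▸ (hc hy).2.2))
    have hley : y ≤ sSup c := le_sSup hy
    have h0 : sSup c ≠ ⊥ := fun h => hy0 (le_bot_iff.1 (h ▸ hley))
    refine ⟨sSup c, ⟨?_, ?_, (hc hy).2.2.trans hley⟩, fun z hz => le_sSup hz⟩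
    · rw [Ideal.ne_top_iff_one, Submodule.mem_sSup_of_directed ⟨y, hy⟩ hdir]
      rintro ⟨J, hJ, h1⟩
      exact (Ideal.ne_top_iff_one J).1 (hc hJ).1 h1
    · refine le_antisymm (fun x hx => ?_) (s.le_star _ (IsFrac.idealK h0))
      obtain ⟨J, hJ0, hJfg, hJ, hxJ⟩ := hft.exists_fg (IsFrac.idealK h0) hx
      have hex : ∃ B ∈ c, J ≤ idealK R K B := by
        obtain ⟨J', rfl⟩ := exists_idealK_eq (hJ.trans (idealK_le_one _))
        have hfg := Submodule.fg_of_fg_map_injective _ (IsFractionRing.injective R K) hJfg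
        obtain ⟨B, hB, h⟩ := (CompleteLattice.isCompactElement_iff_le_of_directed_sSup_le _ _).1
          ((Submodule.fg_iff_compact _).1 hfg) c ⟨y, hy⟩ hdir (idealK_le_idealK.1 hJ)
        exact ⟨B, hB, idealK_le_idealK.2 h⟩
      obtain ⟨B, hB, hJB⟩ := hex
      have hB0 : B ≠ ⊥ := fun h => hA0 (le_bot_iff.1 (h ▸ (hc hB).2.2))
      have := s.star_mono _ _ (IsFrac.of_fg hJ0 hJfg) (IsFrac.idealK hB0) hJB hxJ
      rw [(hc hB).2.1] at this
      exact idealK_le_idealK.2 (le_sSup hB) this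
  obtain ⟨M, hAM, hM⟩ := zorn_le_nonempty₀ _ hub A ⟨hA, hAs, le_rfl⟩
  exact ⟨M, ⟨hM.1.1, hM.1.2.1, fun J hJ hJs h =>
    le_antisymm (hM.2 ⟨hJ, hJs, hAM.trans h⟩ h) h⟩, hM.1.2.2⟩

theorem mem_star_of_forall_maxIdeal (hft : s.FiniteType)
    (hinter : s.Spectral) {I : Submodule R K} (hI : IsFrac R K I) {x : K}
    (h : ∀ M, s.MaxIdeal M → M ≠ ⊥ → ∃ r ∉ M, r • x ∈ I) : x ∈ s.star I := by
  rcases eq_or_ne x 0 with rfl | hx0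
  · exact zero_mem _
  by_contra hx
  have hfr := isFrac_inv_smul_inf_one hI hx0
  have hst := star_inv_smul_inf_one hinter hI hx0
  obtain ⟨A, hA⟩ := exists_idealK_eq (hst.trans_le inf_le_right)
  have hA0 : A ≠ ⊥ := by
    rintro rfl
    exact (s.star_frac _ hfr).1 (by rw [← hA]; exact Submodule.map_bot _)
  have hmem : ∀ r : R, r ∈ A ↔ r • x ∈ s.star I := fun r => by
    rw [← algebraMap_mem_idealK (K := K), hA, hst, Submodule.mem_inf,
      and_iff_left (algebraMap_mem_one r), mem_inv_smul_iff hx0, Algebra.smul_def, mul_comm]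
  obtain ⟨M, hM, hAM⟩ := exists_maxIdeal_le hft (A := A)
    (by rw [Ideal.ne_top_iff_one, hmem, one_smul]; exact hx) hA0 (by rw [hA, s.star_star _ hfr])
  obtain ⟨r, hr, hrx⟩ := h M hM fun h => hA0 (le_bot_iff.1 (h ▸ hAM))
  exact hr (hAM ((hmem r).2 (s.le_star I hI hrx)))

theorem mul_mem_star (hft : s.FiniteType)
    (hinter : s.Spectral) {I J : Submodule R K} (hI : IsFrac R K I) (hJ : IsFrac R K J) {c x : K}
    (h : ∀ i ∈ I, c * i ∈ J) (hx : x ∈ s.star I) : c * x ∈ s.star J := by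
  refine mem_star_of_forall_maxIdeal hft hinter hJ fun M hM hM0 => ?_
  obtain ⟨r, hr, hrx⟩ := exists_notMem_smul_mem hinter hI hx hM.1 hM0 hM.2.1
  exact ⟨r, hr, by simpa using h _ hrx⟩

theorem MaxIdeal.isPrime (hft : s.FiniteType)
    (hinter : s.Spectral) {M : Ideal R} (hM : s.MaxIdeal M) (hM0 : M ≠ ⊥) : M.IsPrime := by
  refine ⟨hM.1, fun {x y} hxy => or_iff_not_imp_left.2 fun hx => ?_⟩
  have hB0 : M ⊔ Ideal.span {x} ≠ ⊥ := fun h => hM0 (le_bot_iff.1 (h ▸ le_sup_left))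
  have hB : IsFrac R K (idealK R K (M ⊔ Ideal.span {x})) := IsFrac.idealK hB0
  obtain ⟨A, hA⟩ := exists_idealK_eq (J := s.star (idealK R K (M ⊔ Ideal.span {x})))
    ((s.star_mono _ _ hB IsFrac.one (idealK_le_one _)).trans_eq s.star_one)
  have hBA : M ⊔ Ideal.span {x} ≤ A := by
    rw [← idealK_le_idealK (K := K), hA]
    exact s.le_star _ hB
  have hxA : x ∈ A := hBA (Ideal.mem_sup_right (Ideal.mem_span_singleton_self x))
  have h1 : (1 : R) ∈ A := by
    by_contra h
    exact hx (hM.2.2 A ((Ideal.ne_top_iff_one A).2 h) (by rw [hA, s.star_star _ hB])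
      (le_sup_left.trans hBA) ▸ hxA)
  rw [← algebraMap_mem_idealK (K := K), hA] at h1
  have := mul_mem_star hft hinter hB (IsFrac.idealK hM0) (c := algebraMap R K y) (fun i hi => ?_) h1
  · rw [hM.2.1, ← map_mul, mul_one, algebraMap_mem_idealK] at this
    exact this
  · obtain ⟨b, hb, rfl⟩ := mem_idealK_iff.1 hi
    rw [← map_mul, algebraMap_mem_idealK]
    obtain ⟨m, hm, z, hz, rfl⟩ := Submodule.mem_sup.1 hb
    obtain ⟨w, rfl⟩ := Ideal.mem_span_singleton'.1 hz
    have : y * (m + w * x) = y * m + w * (x * y) := by ring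
    rw [this]
    exact add_mem (M.mul_mem_left _ hm) (M.mul_mem_left _ hxy)

theorem MaxIdeal.exists_mem_notMem {M N : Ideal R} (hM : s.MaxIdeal M) (hN : s.MaxIdeal N)
    (h : M ≠ N) : ∃ m ∈ M, m ∉ N := by
  by_contra! h'
  exact h (hM.2.2 N hN.1 hN.2.1 h').symm


/-- The trace on `K` of the localization of `I` at the prime ideal `M`. -/
def locAt (M : Ideal R) [hM : M.IsPrime] (I : Submodule R K) : Submodule R K where
  carrier := {x | ∃ r ∉ M, r • x ∈ I}
  zero_mem' := ⟨1, hM.one_notMem, by simp⟩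
  add_mem' := by
    rintro x y ⟨r, hr, hx⟩ ⟨t, ht, hy⟩
    refine ⟨r * t, hM.mul_notMem hr ht, ?_⟩
    rw [smul_add]
    refine add_mem ?_ ?_
    · rw [mul_comm, mul_smul]
      exact I.smul_mem _ hx
    · rw [mul_smul]
      exact I.smul_mem _ hy
  smul_mem' := by
    rintro c x ⟨r, hr, hx⟩
    exact ⟨r, hr, by rw [smul_comm]; exact I.smul_mem _ hx⟩

theorem le_locAt (M : Ideal R) [hM : M.IsPrime] (I : Submodule R K) : I ≤ locAt M I :=
  fun x hx => ⟨1, hM.one_notMem, by simpa using hx⟩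

theorem exists_notMem_smul_mul_mem {M : Ideal R} [hM : M.IsPrime] {I J : Submodule R K}
    (hJ : J.FG) (z : K) (h : ∀ j ∈ J, z * j ∈ locAt M I) : ∃ r ∉ M, ∀ j ∈ J, r • (z * j) ∈ I := by
  induction J, hJ using Submodule.fg_induction with
  | singleton x =>
    obtain ⟨r, hr, hx⟩ := h x (Submodule.mem_span_singleton_self x)
    refine ⟨r, hr, fun j hj => ?_⟩
    obtain ⟨c, rfl⟩ := Submodule.mem_span_singleton.1 hj
    rw [mul_smul_comm, smul_comm]
    exact I.smul_mem _ hx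
  | sup J J' _ _ hJ hJ' =>
    obtain ⟨r, hr, h₁⟩ := hJ fun j hj => h j (Submodule.mem_sup_left hj)
    obtain ⟨t, ht, h₂⟩ := hJ' fun j hj => h j (Submodule.mem_sup_right hj)
    refine ⟨r * t, hM.mul_notMem hr ht, fun j hj => ?_⟩
    obtain ⟨a, ha, b, hb, rfl⟩ := Submodule.mem_sup.1 hj
    rw [mul_add, smul_add]
    refine add_mem ?_ ?_
    · rw [mul_comm, mul_smul]
      exact I.smul_mem _ (h₁ a ha)
    · rw [mul_smul]
      exact I.smul_mem _ (h₂ b hb)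

theorem star_mul_le (hft : s.FiniteType) (hinter : s.Spectral) {I J : Submodule R K}
    (hI : IsFrac R K I) (hJ : IsFrac R K J) : s.star I * J ≤ s.star (I * J) :=
  Submodule.mul_le.2 fun i hi j hj => by
    rw [mul_comm i j]
    refine mul_mem_star hft hinter hI (hI.mul hJ) (fun x hx => ?_) hi
    rw [mul_comm j x]
    exact Submodule.mul_mem_mul hx hj

theorem mul_one_div_le_one (I : Submodule R K) : I * (1 / I) ≤ 1 :=
  Submodule.mul_le.2 fun i hi u hu => by
    rw [mul_comm]
    exact Submodule.mem_div_iff_forall_mul_mem.1 hu i hi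

theorem one_le_div_self (I : Submodule R K) : 1 ≤ I / I := fun x hx => by
  obtain ⟨r, rfl⟩ := Submodule.mem_one.1 hx
  refine Submodule.mem_div_iff_forall_mul_mem.2 fun y hy => ?_
  rw [← Algebra.smul_def]
  exact I.smul_mem _ hy

theorem Stable.star_mul_one_div_eq_one (hft : s.FiniteType) (hinter : s.Spectral)
    {I : Submodule R K} (hst : s.Stable I) (hI : IsFrac R K I)
    (hE : s.star I / s.star I ≤ 1) : s.star (I * (1 / I)) = 1 := by
  have hIs := s.star_frac I hI
  have hfr := hI.mul (IsFrac.one.div hI)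
  rw [Stable, le_antisymm hE (one_le_div_self _)] at hst
  refine le_antisymm ((s.star_mono _ _ hfr IsFrac.one (mul_one_div_le_one I)).trans_eq s.star_one) ?_
  refine hst.symm.trans_le ?_
  rw [← s.star_star _ hfr]
  refine s.star_mono _ _ (hIs.mul (IsFrac.one.div hIs)) (s.star_frac _ hfr) (le_trans ?_
    (star_mul_le hft hinter hI (IsFrac.one.div hI)))
  refine mul_le_mul' le_rfl fun u hu => Submodule.mem_div_iff_forall_mul_mem.2 fun i hi => ?_
  exact Submodule.mem_div_iff_forall_mul_mem.1 hu i (s.le_star I hI hi)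

theorem exists_mul_eq_of_star_mul_one_div {I : Submodule R K} (hI : IsFrac R K I)
    (h : s.star (I * (1 / I)) = 1) {M : Ideal R} (hM : s.MaxIdeal M) (hM0 : M ≠ ⊥) :
    ∃ i ∈ I, ∃ u ∈ 1 / I, ∃ r ∉ M, i * u = algebraMap R K r := by
  by_contra! H
  have hle : I * (1 / I) ≤ idealK R K M := Submodule.mul_le.2 fun i hi u hu => by
    obtain ⟨r, hr⟩ := Submodule.mem_one.1 (mul_one_div_le_one I (Submodule.mul_mem_mul hi hu))
    by_contra hiu
    rw [← hr, algebraMap_mem_idealK] at hiu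
    exact H i hi u hu r hiu hr.symm
  have := s.star_mono _ _ (hI.mul (IsFrac.one.div hI)) (IsFrac.idealK hM0) hle
  rw [h, hM.2.1] at this
  have h1 := this (algebraMap_mem_one 1)
  exact (Ideal.ne_top_iff_one M).1 hM.1 (algebraMap_mem_idealK.1 h1)

theorem star_div_star_le_one_of_fg (hft : s.FiniteType) (hinter : s.Spectral)
    (hic : ∀ x : K, IsIntegral R x → ∃ r : R, algebraMap R K r = x) {J : Submodule R K}
    (hJ : J ≠ ⊥) (hfg : J.FG) : s.star J / s.star J ≤ 1 := fun x hx => by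
  rw [← s.star_one]
  have hfr := IsFrac.of_fg hJ hfg
  refine mem_star_of_forall_maxIdeal hft hinter IsFrac.one fun M hM hM0 => ?_
  have := hM.isPrime hft hinter hM0
  obtain ⟨r, hr, h⟩ := exists_notMem_smul_mul_mem (M := M) (I := J) hfg x fun j hj =>
    exists_notMem_smul_mem hinter hfr
      (Submodule.mem_div_iff_forall_mul_mem.1 hx j (s.le_star _ hfr hj)) hM.1 hM0 hM.2.1
  refine ⟨r, hr, Submodule.mem_one.2 (hic _ ?_)⟩
  obtain ⟨j, hj, hj0⟩ := hfr.exists_mem_ne_zero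
  refine isIntegral_of_smul_mem_submodule J hJ hfg _ fun n hn => ?_
  rw [smul_eq_mul, smul_mul_assoc]
  exact h n hn

/-- The localizations of a Prüfer `*`-multiplication domain at the `*`-maximal ideals are
valuation domains. -/
theorem exists_smul_mem_one_or_inv
    (hP : ∀ J : Submodule R K, J ≠ ⊥ → J.FG → s.star (J * (1 / J)) = 1)
    {M : Ideal R} (hM : s.MaxIdeal M) (hM0 : M ≠ ⊥) {z : K} (hz : z ≠ 0) :
    (∃ r ∉ M, ∃ a : R, algebraMap R K r * z = algebraMap R K a) ∨
      ∃ r ∉ M, ∃ a : R, algebraMap R K r * z⁻¹ = algebraMap R K a := by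
  have hJ0 : Submodule.span R {1, z} ≠ ⊥ :=
    (Submodule.ne_bot_iff _).2 ⟨z, Submodule.subset_span (by simp), hz⟩
  have hfg : (Submodule.span R {1, z}).FG := Submodule.fg_span (Set.toFinite _)
  obtain ⟨i, hi, u, hu, r, hr, h⟩ :=
    exists_mul_eq_of_star_mul_one_div (IsFrac.of_fg hJ0 hfg) (hP _ hJ0 hfg) hM hM0
  rw [Submodule.mem_div_iff_forall_mul_mem] at hu
  obtain ⟨a, ha⟩ := Submodule.mem_one.1 (hu 1 (Submodule.subset_span (by simp)))
  obtain ⟨b, hb⟩ := Submodule.mem_one.1 (hu z (Submodule.subset_span (by simp)))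
  obtain ⟨c, d, rfl⟩ := Submodule.mem_span_pair.1 hi
  have hr' : r = c * a + d * b := by
    apply IsFractionRing.injective R K
    rw [← h, map_add, map_mul, map_mul, ha, hb, Algebra.smul_def, Algebra.smul_def]
    ring
  by_cases haM : a ∈ M
  · refine Or.inr ⟨b, fun hbM => hr ?_, a, by rw [ha, hb]; field_simp⟩
    rw [hr']
    exact add_mem (M.mul_mem_left _ haM) (M.mul_mem_left _ hbM)
  · exact Or.inl ⟨a, haM, b, by rw [ha, hb, mul_one]⟩

theorem MaxIdeal.div_self_le_one (hft : s.FiniteType) (hinter : s.Spectral)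
    (hP : ∀ J : Submodule R K, J ≠ ⊥ → J.FG → s.star (J * (1 / J)) = 1)
    {M : Ideal R} (hM : s.MaxIdeal M) (hM0 : M ≠ ⊥) : idealK R K M / idealK R K M ≤ 1 :=
  fun x hx => by
  rcases eq_or_ne x 0 with rfl | hx0
  · exact zero_mem _
  rw [Submodule.mem_div_iff_forall_mul_mem] at hx
  rw [← s.star_one]
  refine mem_star_of_forall_maxIdeal hft hinter IsFrac.one fun N hN hN0 => ?_
  rcases eq_or_ne M N with rfl | hne
  · rcases exists_smul_mem_one_or_inv hP hM hM0 hx0 with ⟨r, hr, a, ha⟩ | ⟨r, hr, a, ha⟩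
    · exact ⟨r, hr, by rw [Algebra.smul_def, ha]; exact algebraMap_mem_one a⟩
    · by_cases haM : a ∈ M
      · have := hx _ (algebraMap_mem_idealK.2 haM)
        rw [← ha, mul_comm, inv_mul_cancel_right₀ hx0, algebraMap_mem_idealK] at this
        exact absurd this hr
      · refine ⟨a, haM, ?_⟩
        rw [Algebra.smul_def, ← ha, inv_mul_cancel_right₀ hx0]
        exact algebraMap_mem_one r
  · obtain ⟨m, hm, hmN⟩ := hM.exists_mem_notMem hN hne
    refine ⟨m, hmN, ?_⟩
    rw [Algebra.smul_def, mul_comm]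
    exact idealK_le_one M (hx _ (algebraMap_mem_idealK.2 hm))

theorem Stable.star_mul_self_ne (hft : s.FiniteType) (hinter : s.Spectral) {P : Ideal R}
    (hP : P ≠ ⊤) (hP0 : P ≠ ⊥) (hPs : s.star (idealK R K P) = idealK R K P)
    (hst : s.Stable (idealK R K P)) : s.star (idealK R K P * idealK R K P) ≠ idealK R K P := by
  intro h
  have hfr : IsFrac R K (idealK R K P) := IsFrac.idealK hP0
  rw [Stable, hPs] at hst
  have hle : idealK R K P * (idealK R K P / idealK R K P / idealK R K P) ≤ idealK R K P := by
    refine Submodule.mul_le.2 fun p hp u hu => ?_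
    rw [← h] at hp
    have := mul_mem_star hft hinter (hfr.mul hfr) hfr (c := u) (fun i hi => ?_) hp
    · rwa [hPs, mul_comm] at this
    · rw [Submodule.mem_div_iff_forall_mul_mem] at hu
      refine Submodule.mul_induction_on hi (fun m hm n hn => ?_) fun m n hm hn => ?_
      · rw [← mul_assoc]
        exact Submodule.mem_div_iff_forall_mul_mem.1 (hu m hm) n hn
      · rw [mul_add]
        exact add_mem hm hn
  have h1 := s.star_mono _ _ (hfr.mul ((hfr.div hfr).div hfr)) hfr hle
  rw [hst, hPs] at h1
  have h2 := h1 (one_le_div_self _ (algebraMap_mem_one 1))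
  exact (Ideal.ne_top_iff_one P).1 hP (algebraMap_mem_idealK.1 h2)

section FiniteCharacter

variable {a : R}

theorem one_le_one_div_idealK (M : Ideal R) : 1 ≤ 1 / idealK R K M :=
  (one_le_div_self 1).trans fun _ hx => Submodule.mem_div_iff_forall_mul_mem.2 fun y hy =>
    Submodule.mem_div_iff_forall_mul_mem.1 hx y (idealK_le_one M hy)

variable (s K a) in
/-- The sum of the inverses of the `*`-maximal ideals that contain `a`. -/
def sumInv : Submodule R K := ⨆ M : {M : Ideal R | s.MaxIdeal M ∧ a ∈ M}, 1 / idealK R K M.1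

theorem one_div_idealK_le_sumInv {M : Ideal R} (hM : s.MaxIdeal M) (haM : a ∈ M) :
    1 / idealK R K M ≤ s.sumInv K a :=
  le_iSup (fun M : {M : Ideal R | s.MaxIdeal M ∧ a ∈ M} => 1 / idealK R K M.1) ⟨M, hM, haM⟩

theorem algebraMap_mul_mem_one_of_mem_sumInv {x : K} (hx : x ∈ s.sumInv K a) :
    algebraMap R K a * x ∈ (1 : Submodule R K) := by
  have : s.sumInv K a ≤ 1 / idealK R K (Ideal.span {a}) := by
    refine iSup_le fun M y hy => ?_
    rw [Submodule.mem_div_iff_forall_mul_mem] at hy ⊢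
    exact fun z hz => hy z (idealK_le_idealK.2
      ((Ideal.span_singleton_le_iff_mem _).2 M.2.2) hz)
  rw [mul_comm]
  exact Submodule.mem_div_iff_forall_mul_mem.1 (this hx) _
    (algebraMap_mem_idealK.2 (Ideal.mem_span_singleton_self a))

theorem sumInv_le_locAt {N : Ideal R} [hNp : N.IsPrime] (hN : s.MaxIdeal N) :
    s.sumInv K a ≤ locAt N (1 / idealK R K N) := by
  refine iSup_le fun ⟨M, hM, _⟩ => ?_
  rcases eq_or_ne M N with rfl | hne
  · exact le_locAt _ _
  intro y hy
  obtain ⟨m, hm, hmN⟩ := hM.exists_mem_notMem hN hne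
  refine ⟨m, hmN, one_le_one_div_idealK N ?_⟩
  rw [Algebra.smul_def, mul_comm]
  exact Submodule.mem_div_iff_forall_mul_mem.1 hy _ (algebraMap_mem_idealK.2 hm)

theorem isFrac_sumInv (ha : a ≠ 0) {M : Ideal R} (hM : s.MaxIdeal M) (haM : a ∈ M) :
    IsFrac R K (s.sumInv K a) := by
  refine ⟨?_, a, ha, fun x hx => ?_⟩
  · exact (Submodule.ne_bot_iff _).2 ⟨1, one_div_idealK_le_sumInv hM haM
      (one_le_one_div_idealK M (Submodule.one_le.1 le_rfl)), one_ne_zero⟩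
  · obtain ⟨b, hb⟩ := Submodule.mem_one.1 (algebraMap_mul_mem_one_of_mem_sumInv hx)
    exact ⟨b, hb.symm⟩

theorem star_sumInv_div_le_one (hft : s.FiniteType) (hinter : s.Spectral) (ha : a ≠ 0)
    (hinv : ∀ M : Ideal R, s.MaxIdeal M → a ∈ M →
      s.star (idealK R K M * (1 / idealK R K M)) = 1)
    {M : Ideal R} (hM : s.MaxIdeal M) (haM : a ∈ M) :
    s.star (s.sumInv K a) / s.star (s.sumInv K a) ≤ 1 := fun x hx => by
  have hfr : IsFrac R K (s.sumInv K a) := isFrac_sumInv ha hM haM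
  have hle := s.le_star _ hfr
  rw [Submodule.mem_div_iff_forall_mul_mem] at hx
  rw [← s.star_one]
  refine mem_star_of_forall_maxIdeal hft hinter IsFrac.one fun N hN hN0 => ?_
  have hNp := hN.isPrime hft hinter hN0
  by_cases haN : a ∈ N
  · obtain ⟨n, hn, u, hu, r, hr, h⟩ :=
      exists_mul_eq_of_star_mul_one_div (IsFrac.idealK hN0) (hinv N hN haN) hN hN0
    obtain ⟨t, ht, hxu⟩ := exists_notMem_smul_mem hinter hfr
      (hx u (hle (one_div_idealK_le_sumInv hN haN hu))) hN.1 hN0 hN.2.1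
    obtain ⟨t', ht', hxu'⟩ := sumInv_le_locAt hN hxu
    refine ⟨t' * t * r, hNp.mul_notMem (hNp.mul_notMem ht' ht) hr, ?_⟩
    convert Submodule.mem_div_iff_forall_mul_mem.1 hxu' n hn using 1
    simp only [Algebra.smul_def, map_mul, ← h]
    ring
  · have h1 : (1 : K) ∈ s.star (s.sumInv K a) := hle (one_div_idealK_le_sumInv hM haM
      (one_le_one_div_idealK M (Submodule.one_le.1 le_rfl)))
    obtain ⟨t, ht, hxt⟩ := exists_notMem_smul_mem hinter hfr (hx 1 h1) hN.1 hN0 hN.2.1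
    refine ⟨a * t, hNp.mul_notMem haN ht, ?_⟩
    rw [mul_smul, Algebra.smul_def a, ← mul_one x]
    exact algebraMap_mul_mem_one_of_mem_sumInv hxt

theorem finite_setOf_maxIdeal (hft : s.FiniteType) (hinter : s.Spectral) (ha : a ≠ 0)
    (hinv : ∀ M : Ideal R, s.MaxIdeal M → a ∈ M →
      s.star (idealK R K M * (1 / idealK R K M)) = 1)
    (hst : ∀ I : Submodule R K, IsFrac R K I → s.Stable I) :
    {M : Ideal R | s.MaxIdeal M ∧ a ∈ M}.Finite := by
  classical
  by_contra hfin
  obtain ⟨M, hM, haM⟩ := Set.Infinite.nonempty hfin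
  have hfr : IsFrac R K (s.sumInv K a) := isFrac_sumInv ha hM haM
  have hone := (hst _ hfr).star_mul_one_div_eq_one hft hinter hfr
    (star_sumInv_div_le_one hft hinter ha hinv hM haM)
  have hB : ∀ N, s.MaxIdeal N → a ∈ N → 1 / s.sumInv K a ≤ idealK R K N := by
    intro N hN haN x hx
    have hN0 : N ≠ ⊥ := fun h => ha (by rw [h] at haN; exact haN)
    have hNp := hN.isPrime hft hinter hN0
    obtain ⟨n, hn, u, hu, r, hr, h⟩ :=
      exists_mul_eq_of_star_mul_one_div (IsFrac.idealK hN0) (hinv N hN haN) hN hN0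
    rw [Submodule.mem_div_iff_forall_mul_mem] at hx
    obtain ⟨b, hb⟩ := Submodule.mem_one.1 (hx 1 (one_div_idealK_le_sumInv hM haM
      (one_le_one_div_idealK M (Submodule.one_le.1 le_rfl))))
    obtain ⟨c, hc⟩ := Submodule.mem_one.1 (hx u (one_div_idealK_le_sumInv hN haN hu))
    obtain ⟨m, hm, rfl⟩ := mem_idealK_iff.1 hn
    rw [mul_one] at hb
    rw [← hb, algebraMap_mem_idealK]
    have hbr : b * r = m * c := by
      apply IsFractionRing.injective R K
      rw [map_mul, map_mul, hb, hc, ← h]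
      ring
    exact (hNp.mem_or_mem (hbr ▸ N.mul_mem_right c hm : b * r ∈ N)).resolve_right hr
  have hmul := hfr.mul (IsFrac.one.div hfr)
  obtain ⟨H, hH0, hHfg, hH, h1⟩ := hft.exists_fg hmul (hone ▸ algebraMap_mem_one 1)
  have hle := hH
  rw [sumInv, Submodule.iSup_mul, ← sSup_range] at hle
  obtain ⟨t, ht, hHt⟩ := (CompleteLattice.isCompactElement_iff_exists_le_sSup_of_le_sSup _ _).1
    ((Submodule.fg_iff_compact _).1 hHfg) _ hle
  rw [← Set.image_univ] at ht
  obtain ⟨F, -, rfl⟩ := Finset.subset_set_image_iff.1 ht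
  refine hfin (Set.finite_coe_iff.1 (Set.finite_univ_iff.1
    (F.finite_toSet.subset fun ⟨N, hN, haN⟩ _ => ?_)))
  by_contra hNF
  have hN0 : N ≠ ⊥ := fun h => ha (by rw [h] at haN; exact haN)
  have hNp := hN.isPrime hft hinter hN0
  obtain ⟨r, hr, hr1⟩ := exists_notMem_smul_mem hinter (IsFrac.of_fg hH0 hHfg) h1 hN.1 hN0 hN.2.1
  have hloc : (F.image fun M => 1 / idealK R K M.1 * (1 / s.sumInv K a)).sup id ≤
      locAt N (idealK R K N) := by
    refine Finset.sup_le fun X hX => ?_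
    obtain ⟨⟨L, hL, haL⟩, hLF, rfl⟩ := Finset.mem_image.1 hX
    have hne : L ≠ N := by
      rintro rfl
      exact hNF hLF
    obtain ⟨m, hm, hmN⟩ := hL.exists_mem_notMem hN hne
    refine Submodule.mul_le.2 fun u hu b hb => ⟨m, hmN, ?_⟩
    obtain ⟨c, hc⟩ := Submodule.mem_one.1
      (Submodule.mem_div_iff_forall_mul_mem.1 hu _ (algebraMap_mem_idealK.2 hm))
    rw [Algebra.smul_def, ← mul_assoc, mul_comm _ u, ← hc, ← Algebra.smul_def]
    exact Submodule.smul_mem _ _ (hB N hN haN hb)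
  obtain ⟨r', hr', h⟩ := hloc (hHt hr1)
  rw [← mul_smul, Algebra.smul_def, map_one, mul_one, algebraMap_mem_idealK] at h
  exact hNp.mul_notMem hr' hr h

end FiniteCharacter

section Discrete

/-- The multiplier ring in `K` of the localization of `I` at the prime ideal `M`. -/
def multiplierAt (M : Ideal R) [M.IsPrime] (I : Submodule R K) : Subring K where
  carrier := {z | ∀ i ∈ I, z * i ∈ locAt M I}
  zero_mem' i _ := by rw [zero_mul]; exact zero_mem _
  one_mem' i hi := by rw [one_mul]; exact le_locAt M I hi
  add_mem' hx hy i hi := by rw [add_mul]; exact add_mem (hx i hi) (hy i hi)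
  neg_mem' hx i hi := by rw [neg_mul]; exact neg_mem (hx i hi)
  mul_mem' {x y} hx hy i hi := by
    obtain ⟨r, hr, h⟩ := hy i hi
    obtain ⟨t, ht, h'⟩ := hx _ h
    refine ⟨t * r, Ideal.IsPrime.mul_notMem ‹_› ht hr, ?_⟩
    rw [mul_smul, mul_assoc, ← mul_smul_comm]
    exact h'

theorem algebraMap_mem_multiplierAt (M : Ideal R) [M.IsPrime] (I : Submodule R K) (r : R) :
    algebraMap R K r ∈ multiplierAt M I := fun i hi => by
  rw [← Algebra.smul_def]
  exact Submodule.smul_mem _ _ (le_locAt M I hi)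

theorem inv_algebraMap_mem_multiplierAt (M : Ideal R) [M.IsPrime] (I : Submodule R K) {r : R}
    (hr : r ∉ M) : (algebraMap R K r)⁻¹ ∈ multiplierAt M I := fun i hi => by
  have hr0 : algebraMap R K r ≠ 0 := fun h => hr (by
    rw [map_eq_zero_iff _ (IsFractionRing.injective R K)] at h
    simp [h])
  refine ⟨r, hr, ?_⟩
  rw [Algebra.smul_def, mul_inv_cancel_left₀ hr0]
  exact hi

theorem mem_or_inv_mem_multiplierAt
    (hP : ∀ J : Submodule R K, J ≠ ⊥ → J.FG → s.star (J * (1 / J)) = 1)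
    {M : Ideal R} [M.IsPrime] (hM : s.MaxIdeal M) (hM0 : M ≠ ⊥) (I : Submodule R K) (z : K) :
    z ∈ multiplierAt M I ∨ z⁻¹ ∈ multiplierAt M I := by
  have key : ∀ w : K, (∃ r ∉ M, ∃ a : R, algebraMap R K r * w = algebraMap R K a) →
      w ∈ multiplierAt M I := by
    rintro w ⟨r, hr, a, h⟩
    have hr0 : algebraMap R K r ≠ 0 := fun h => hr (by
      rw [map_eq_zero_iff _ (IsFractionRing.injective R K)] at h
      simp [h])
    rw [← inv_mul_cancel_left₀ hr0 w, h]
    exact mul_mem (inv_algebraMap_mem_multiplierAt M I hr) (algebraMap_mem_multiplierAt M I a)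
  rcases eq_or_ne z 0 with rfl | hz
  · exact Or.inl (zero_mem _)
  · exact (exists_smul_mem_one_or_inv hP hM hM0 hz).imp (key z) (key _)

/-- The elements of `R` of value less than one, for a valuation whose ring contains `R`. -/
def centerIdeal (v : ValuationSubring K) (hv : ∀ r : R, algebraMap R K r ∈ v) : Ideal R where
  carrier := {r | v.valuation (algebraMap R K r) < 1}
  zero_mem' := by simp
  add_mem' {x y} hx hy := by
    change v.valuation (algebraMap R K (x + y)) < 1
    rw [map_add]
    exact Valuation.map_add_lt _ hx hy
  smul_mem' c x hx := by
    change v.valuation (algebraMap R K (c * x)) < 1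
    rw [map_mul, map_mul]
    exact lt_of_le_of_lt (mul_le_of_le_one_left' ((v.valuation_le_one_iff _).2 (hv c))) hx

theorem valuation_eq_one_of_notMem_centerIdeal {v : ValuationSubring K}
    {hv : ∀ r : R, algebraMap R K r ∈ v} {r : R} (hr : r ∉ centerIdeal v hv) :
    v.valuation (algebraMap R K r) = 1 :=
  le_antisymm ((v.valuation_le_one_iff _).2 (hv r)) (not_lt.1 hr)

instance (v : ValuationSubring K) (hv : ∀ r : R, algebraMap R K r ∈ v) :
    (centerIdeal v hv).IsPrime where
  ne_top' := by
    rw [Ideal.ne_top_iff_one]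
    intro h
    have h' : v.valuation (algebraMap R K 1) < 1 := h
    rw [map_one, map_one] at h'
    exact lt_irrefl _ h'
  mem_or_mem' {x y} h := by
    by_contra! H
    have h' : v.valuation (algebraMap R K (x * y)) < 1 := h
    rw [map_mul, map_mul, valuation_eq_one_of_notMem_centerIdeal H.1,
      valuation_eq_one_of_notMem_centerIdeal H.2, mul_one] at h'
    exact lt_irrefl _ h'

/-- In a strongly `*`-discrete Prüfer `*`-multiplication domain the localization of a fractional
ideal at a `*`-maximal ideal is principal over its multiplier ring. -/
theorem exists_forall_div_mem_multiplierAt (hft : s.FiniteType) (hinter : s.Spectral)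
    (hP : ∀ J : Submodule R K, J ≠ ⊥ → J.FG → s.star (J * (1 / J)) = 1)
    (hsd : ∀ P : Ideal R, P.IsPrime → P ≠ ⊥ → s.star (idealK R K P) = idealK R K P →
      s.star (idealK R K P * idealK R K P) ≠ idealK R K P)
    {M : Ideal R} [hMp : M.IsPrime] (hM : s.MaxIdeal M) (hM0 : M ≠ ⊥) {I : Submodule R K}
    (hI : IsFrac R K I) : ∃ x ∈ I, x ≠ 0 ∧ ∀ y ∈ I, y / x ∈ multiplierAt M I := by
  by_contra! H
  let W : ValuationSubring K :=
    { multiplierAt M I with mem_or_inv_mem' := mem_or_inv_mem_multiplierAt hP hM hM0 I }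
  have hRW : ∀ r : R, algebraMap R K r ∈ W := algebraMap_mem_multiplierAt M I
  have hW : ∀ z, z ∈ multiplierAt M I ↔ W.valuation z ≤ 1 := fun z =>
    (W.valuation_le_one_iff z).symm
  let P := centerIdeal W hRW
  have hPp : P.IsPrime := inferInstance
  have hPmem : ∀ r, r ∈ P ↔ W.valuation (algebraMap R K r) < 1 := fun r => Iff.rfl
  have hP1 : ∀ r, r ∉ P → W.valuation (algebraMap R K r) = 1 := fun r hr =>
    valuation_eq_one_of_notMem_centerIdeal hr
  have hPM : P ≤ M := by
    intro r hr
    by_contra hrM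
    have h1 := (hW _).1 (inv_algebraMap_mem_multiplierAt M I hrM)
    rw [map_inv₀] at h1
    have hr0 : r ≠ 0 := by
      rintro rfl
      exact hrM M.zero_mem
    have h0 : W.valuation (algebraMap R K r) ≠ 0 := by simpa using hr0
    exact not_lt.2 ((inv_le_one₀ (zero_lt_iff.2 h0)).1 h1) hr
  have hnum : ∀ z, W.valuation z < 1 → ∃ t, t ∉ P ∧ t ∉ M ∧ ∃ r ∈ P,
      algebraMap R K t * z = algebraMap R K r := by
    intro z hz
    rcases eq_or_ne z 0 with rfl | hz0
    · exact ⟨1, hPp.one_notMem, hMp.one_notMem, 0, P.zero_mem, by simp⟩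
    rcases exists_smul_mem_one_or_inv hP hM hM0 hz0 with ⟨r, hr, a, h⟩ | ⟨r, hr, a, h⟩
    · have hrP : r ∉ P := fun h => hr (hPM h)
      refine ⟨r, hrP, hr, a, (hPmem a).2 ?_, h⟩
      rw [← h, map_mul, hP1 r hrP, one_mul]
      exact hz
    · have hrP : r ∉ P := fun h => hr (hPM h)
      have h1 : W.valuation (algebraMap R K a) ≤ 1 := (W.valuation_le_one_iff _).2 (hRW a)
      rw [← h, map_mul, hP1 r hrP, one_mul, map_inv₀] at h1
      exact absurd hz (not_lt.2 ((inv_le_one₀ (zero_lt_iff.2 (by simpa using hz0))).1 h1))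
  have hstep : ∀ x ∈ I, x ≠ 0 → ∃ y ∈ I, W.valuation (x / y) < 1 ∧ y ≠ 0 := by
    intro x hx hx0
    obtain ⟨y, hy, hyx⟩ := H x hx hx0
    rw [hW, not_le] at hyx
    have hy0 : y ≠ 0 := by
      rintro rfl
      simp at hyx
    refine ⟨y, hy, ?_, hy0⟩
    rw [← inv_div, map_inv₀]
    exact inv_lt_one_of_one_lt₀ hyx
  obtain ⟨x₀, hx₀, hx₀0⟩ := hI.exists_mem_ne_zero
  have hPbot : P ≠ ⊥ := by
    intro hbot
    obtain ⟨y, -, hlt, hy0⟩ := hstep x₀ hx₀ hx₀0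
    obtain ⟨t, htP, -, r, hr, h⟩ := hnum _ hlt
    rw [hbot, Ideal.mem_bot] at hr
    rw [hr, map_zero, mul_eq_zero, or_iff_left (div_ne_zero hx₀0 hy0),
      map_eq_zero_iff _ (IsFractionRing.injective R K)] at h
    exact htP (h ▸ P.zero_mem)
  have hPfr : IsFrac R K (idealK R K P) := IsFrac.idealK hPbot
  have hPs : s.star (idealK R K P) = idealK R K P := by
    refine le_antisymm (fun x hx => ?_) (s.le_star _ hPfr)
    obtain ⟨r, rfl⟩ := Submodule.mem_one.1
      (s.star_one ▸ s.star_mono _ _ hPfr IsFrac.one (idealK_le_one P) hx)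
    obtain ⟨t, ht, h⟩ := exists_notMem_smul_mem hinter hPfr hx hM.1 hM0 hM.2.1
    rw [Algebra.smul_def, ← map_mul, algebraMap_mem_idealK] at h
    exact algebraMap_mem_idealK.2 ((hPp.mem_or_mem h).resolve_left fun h => ht (hPM h))
  have hle : s.star (idealK R K P * idealK R K P) ≤ idealK R K P := by
    refine (s.star_mono _ _ (hPfr.mul hPfr) hPfr (Submodule.mul_le.2 fun m hm n hn => ?_)).trans_eq
      hPs
    obtain ⟨c, -, rfl⟩ := mem_idealK_iff.1 hm
    rw [← Algebra.smul_def]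
    exact Submodule.smul_mem _ _ hn
  obtain ⟨p', hp', hpn⟩ := SetLike.exists_of_lt (lt_of_le_of_ne hle (hsd P hPp hPbot hPs))
  obtain ⟨p, hp, rfl⟩ := mem_idealK_iff.1 hp'
  have hp0 : algebraMap R K p ≠ 0 := fun h => hpn (h ▸ zero_mem _)
  have hN : ∃ N : Ideal R, s.MaxIdeal N ∧ N ≠ ⊥ ∧
      ∀ r ∉ N, r • algebraMap R K p ∉ idealK R K P * idealK R K P := by
    by_contra! h
    exact hpn (mem_star_of_forall_maxIdeal hft hinter (hPfr.mul hPfr) h)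
  obtain ⟨N, hN, hN0, hNp⟩ := hN
  have hPN : P ≤ N := by
    intro q hq
    by_contra hqN
    refine hNp q hqN ?_
    rw [Algebra.smul_def]
    exact Submodule.mul_mem_mul (algebraMap_mem_idealK.2 hq) (algebraMap_mem_idealK.2 hp)
  have hmax : ∀ q ∈ P, W.valuation (algebraMap R K q) ≤ W.valuation (algebraMap R K p) := by
    intro q hq
    by_contra! hlt
    have hq0 : algebraMap R K q ≠ 0 := fun h => by
      rw [h, map_zero] at hlt
      exact not_lt_zero hlt
    obtain ⟨t, htP, -, r, hr, h⟩ := hnum (algebraMap R K p / algebraMap R K q) (by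
      rw [map_div₀]
      exact (div_lt_one₀ (zero_lt_iff.2 (by simpa using hq0))).2 hlt)
    have htpq : algebraMap R K t * algebraMap R K p = algebraMap R K r * algebraMap R K q := by
      rw [← h]
      field_simp
    have ht0 : algebraMap R K t ≠ 0 := fun h => htP (by
      rw [map_eq_zero_iff _ (IsFractionRing.injective R K)] at h
      exact h ▸ P.zero_mem)
    have hr0 : algebraMap R K r ≠ 0 := fun h => mul_ne_zero ht0 hp0 (by rw [htpq, h, zero_mul])
    rcases exists_smul_mem_one_or_inv hP hN hN0 (div_ne_zero hr0 ht0) with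
      ⟨c, hc, b, hb⟩ | ⟨c, hc, b, hb⟩
    · have hcr : algebraMap R K c * algebraMap R K r = algebraMap R K b * algebraMap R K t := by
        rw [← hb]
        field_simp
      have hbP : b ∈ P := by
        rw [← map_mul, ← map_mul] at hcr
        have hbt := IsFractionRing.injective R K hcr
        exact (hPp.mem_or_mem (hbt ▸ P.mul_mem_left c hr : b * t ∈ P)).resolve_right htP
      refine hNp c hc ?_
      have : c • algebraMap R K p = algebraMap R K b * algebraMap R K q := by
        apply mul_left_cancel₀ ht0
        rw [Algebra.smul_def, mul_left_comm, htpq, ← mul_assoc, hcr]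
        ring
      rw [this]
      exact Submodule.mul_mem_mul (algebraMap_mem_idealK.2 hbP) (algebraMap_mem_idealK.2 hq)
    · have hct : algebraMap R K c * algebraMap R K t = algebraMap R K b * algebraMap R K r := by
        rw [← hb]
        field_simp
      rw [← map_mul, ← map_mul] at hct
      have hct' := IsFractionRing.injective R K hct
      rcases hPp.mem_or_mem (hct' ▸ P.mul_mem_left b hr : c * t ∈ P) with h | h
      · exact hc (hPN h)
      · exact htP h
  have hpinv : (algebraMap R K p)⁻¹ ∈ multiplierAt M I := by
    intro x hx
    rcases eq_or_ne x 0 with rfl | hx0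
    · rw [mul_zero]
      exact zero_mem _
    obtain ⟨y, hy, hlt, hy0⟩ := hstep x hx hx0
    obtain ⟨t, htP, -, r, hr, h⟩ := hnum _ hlt
    have hv : W.valuation (x / y) ≤ W.valuation (algebraMap R K p) := by
      have := hmax r hr
      rwa [← h, map_mul, hP1 t htP, one_mul] at this
    have hz : x / y / algebraMap R K p ∈ multiplierAt M I := by
      rw [hW, map_div₀]
      exact (div_le_one₀ (zero_lt_iff.2 (by simpa using hp0))).2 hv
    convert hz y hy using 1
    field_simp
  rw [hW, map_inv₀] at hpinv
  exact not_lt.2 ((inv_le_one₀ (zero_lt_iff.2 (by simpa using hp0))).1 hpinv) hp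

theorem integral_mem_of_star_mul_one_div (hft : s.FiniteType) (hinter : s.Spectral)
    (hP : ∀ J : Submodule R K, J ≠ ⊥ → J.FG → s.star (J * (1 / J)) = 1) {x : K}
    (hx : IsIntegral R x) : ∃ r : R, algebraMap R K r = x := by
  let J := (Algebra.adjoin R {x}).toSubmodule
  have hfg : J.FG := hx.fg_adjoin_singleton
  have hJ : J ≠ ⊥ := (Submodule.ne_bot_iff _).2 ⟨1, one_mem (Algebra.adjoin R {x}), one_ne_zero⟩
  have hfr := IsFrac.of_fg hJ hfg
  have hmul := hfr.mul (IsFrac.one.div hfr)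
  have h1 : (1 : K) ∈ s.star (J * (1 / J)) := by
    rw [hP J hJ hfg]
    exact Submodule.one_le.1 le_rfl
  have := mul_mem_star hft hinter hmul IsFrac.one (c := x) (fun i hi => ?_) h1
  · rw [s.star_one, mul_one] at this
    exact Submodule.mem_one.1 this
  · refine mul_one_div_le_one J (Submodule.mul_induction_on hi (fun m hm n hn => ?_)
      fun m n hm hn => ?_)
    · rw [← mul_assoc]
      exact Submodule.mul_mem_mul
        (mul_mem (Algebra.self_mem_adjoin_singleton R x) hm : x * m ∈ Algebra.adjoin R {x}) hn
    · rw [mul_add]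
      exact add_mem hm hn

theorem stable_of_strongly_discrete (hft : s.FiniteType) (hinter : s.Spectral)
    (hP : ∀ J : Submodule R K, J ≠ ⊥ → J.FG → s.star (J * (1 / J)) = 1)
    (hsd : ∀ P : Ideal R, P.IsPrime → P ≠ ⊥ → s.star (idealK R K P) = idealK R K P →
      s.star (idealK R K P * idealK R K P) ≠ idealK R K P)
    (hfin : ∀ r : R, r ≠ 0 → {M : Ideal R | s.MaxIdeal M ∧ r ∈ M}.Finite)
    {I₀ : Submodule R K} (hI₀ : IsFrac R K I₀) : s.Stable I₀ := by
  rw [Stable]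
  have hI := s.star_frac I₀ hI₀
  have hIs := s.star_star I₀ hI₀
  generalize s.star I₀ = I at hI hIs
  have hE := hI.div hI
  have hT := hI.mul (hE.div hI)
  have hloc : ∀ z : K, (∀ M, s.MaxIdeal M → M ≠ ⊥ → ∃ r ∉ M, r • z ∈ I) → z ∈ I := fun z hz =>
    hIs ▸ mem_star_of_forall_maxIdeal hft hinter hI hz
  obtain ⟨a, haI, ha0⟩ := hI.exists_mem_ne_zero
  obtain ⟨d, hd, hdI⟩ := hI.2
  obtain ⟨b, hb⟩ := hdI a haI
  have hd0 : algebraMap R K d ≠ 0 := by simpa using hd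
  have hb0 : b ≠ 0 := by
    rintro rfl
    rw [map_zero] at hb
    exact mul_ne_zero hd0 ha0 hb
  have hbM : ∀ M : Ideal R, b ∈ M → M ≠ ⊥ := by
    rintro M h rfl
    exact hb0 h
  have hgen : ∀ M : {M : Ideal R | s.MaxIdeal M ∧ b ∈ M}, ∃ x ∈ I, x ≠ 0 ∧
      ∀ y ∈ I, ∀ i ∈ I, ∃ r ∉ M.1, r • (y / x * i) ∈ I := by
    rintro ⟨M, hM, hbM'⟩
    have := hM.isPrime hft hinter (hbM M hbM')
    exact exists_forall_div_mem_multiplierAt hft hinter hP hsd hM (hbM M hbM') hI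
  choose g hgI hg0 hg using hgen
  have := (hfin b hb0).to_subtype
  let J := Submodule.span R (insert a (Set.range g))
  have haJ : a ∈ J := Submodule.subset_span (Set.mem_insert _ _)
  have hgJ : ∀ M, g M ∈ J := fun M => Submodule.subset_span (Or.inr ⟨M, rfl⟩)
  have hJfg : J.FG := Submodule.fg_span ((Set.finite_range g).insert a)
  have hJ0 : J ≠ ⊥ := (Submodule.ne_bot_iff _).2 ⟨a, haJ, ha0⟩
  have hJI : J ≤ I := by
    refine Submodule.span_le.2 (Set.insert_subset haI ?_)
    rintro _ ⟨M, rfl⟩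
    exact hgI M
  have hJfr := IsFrac.of_fg hJ0 hJfg
  have hinvJ : 1 / J ≤ I / I / I := by
    intro u hu
    rw [Submodule.mem_div_iff_forall_mul_mem] at hu ⊢
    intro y hy
    rw [Submodule.mem_div_iff_forall_mul_mem]
    intro i hi
    refine hloc _ fun M hM hM0 => ?_
    have hMp := hM.isPrime hft hinter hM0
    by_cases hbm : b ∈ M
    · have hx0 := hg0 ⟨M, hM, hbm⟩
      set x := g ⟨M, hM, hbm⟩ with hx
      obtain ⟨r, hr, hrJ⟩ := exists_notMem_smul_mul_mem (M := M) (I := I) hJfg (y / x)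
        fun j hj => hg ⟨M, hM, hbm⟩ y hy j (hJI hj)
      have hrE : ∀ i ∈ I, r • (y / x * i) ∈ I := by
        intro i hi
        refine hloc _ fun N hN hN0 => ?_
        have hNp := hN.isPrime hft hinter hN0
        by_cases hbN : b ∈ N
        · obtain ⟨t, ht, h⟩ := hg ⟨N, hN, hbN⟩ _ (hrJ _ (hgJ ⟨N, hN, hbN⟩)) i hi
          refine ⟨t, ht, ?_⟩
          convert h using 2
          have := hg0 ⟨N, hN, hbN⟩
          rw [Algebra.smul_def, Algebra.smul_def]
          field_simp
        · obtain ⟨c, hc⟩ := hdI i hi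
          refine ⟨b, hbN, ?_⟩
          have : b • (r • (y / x * i)) = c • (r • (y / x * a)) := by
            simp only [Algebra.smul_def]
            rw [← hb, ← hc]
            ring
          rw [this]
          exact I.smul_mem _ (hrJ a haJ)
      obtain ⟨c, hc⟩ := Submodule.mem_one.1 (hu x (hgJ _))
      refine ⟨r, hr, ?_⟩
      have : r • (u * y * i) = c • (r • (y / x * i)) := by
        simp only [Algebra.smul_def]
        rw [hc]
        field_simp
      rw [this]
      exact I.smul_mem _ (hrE i hi)
    · obtain ⟨c, hc⟩ := hdI y hy
      obtain ⟨e, he⟩ := Submodule.mem_one.1 (hu a haJ)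
      refine ⟨b, hbm, ?_⟩
      have : b • (u * y * i) = (c * e) • i := by
        simp only [Algebra.smul_def, map_mul]
        rw [he, ← hc, ← hb]
        ring
      rw [this]
      exact I.smul_mem _ hi
  have h1 : (1 : K) ∈ s.star (I * (I / I / I)) := by
    refine s.star_mono _ _ (hJfr.mul (IsFrac.one.div hJfr)) hT (mul_le_mul' hJI hinvJ) ?_
    rw [hP J hJ0 hJfg]
    exact Submodule.one_le.1 le_rfl
  refine le_antisymm (fun z hz => ?_) fun e he => ?_
  · rw [Submodule.mem_div_iff_forall_mul_mem]
    intro i hi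
    rw [mul_comm, ← hIs]
    refine mul_mem_star hft hinter hT hI (fun w hw => ?_) hz
    rw [mul_comm]
    have hle : I * (I / I / I) ≤ I / I := Submodule.mul_le.2 fun m hm n hn => by
      rw [mul_comm]
      exact Submodule.mem_div_iff_forall_mul_mem.1 hn m hm
    exact Submodule.mem_div_iff_forall_mul_mem.1 (hle hw) i hi
  · rw [← mul_one e]
    refine mul_mem_star hft hinter hT hT (fun w hw => ?_) h1
    refine Submodule.mul_induction_on hw (fun m hm n hn => ?_) fun m n hm hn => ?_
    · rw [← mul_assoc]
      exact Submodule.mul_mem_mul (Submodule.mem_div_iff_forall_mul_mem.1 he m hm) hn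
    · rw [mul_add]
      exact add_mem hm hn

end Discrete

end StarOperation

end StarOperation

/-- Let `*` be a star operation on `R` which is spectral and of finite type
(i.e. of finite type and distributing over finite intersections). Then `R` is integrally
closed and `*`-stable if and only if `R` is a strongly `*`-discrete Prüfer
`*`-multiplication domain with `*`-finite character. -/
theorem integrally_closed_star_stable_iff_strongly_discrete_pstarmd
    {R K : Type*} [CommRing R] [IsDomain R] [Field K] [Algebra R K] [IsFractionRing R K]
    (s : StarOperation R K) (hft : s.FiniteType)
    (hinter : ∀ I J : Submodule R K, IsFrac R K I → IsFrac R K J →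
      s.star (I ⊓ J) = s.star I ⊓ s.star J) :
    ((∀ x : K, IsIntegral R x → ∃ r : R, algebraMap R K r = x) ∧
        ∀ I : Submodule R K, IsFrac R K I → s.Stable I) ↔
      ((∀ J : Submodule R K, J ≠ ⊥ → J.FG → s.star (J * (1 / J)) = 1) ∧
        (∀ P : Ideal R, P.IsPrime → P ≠ ⊥ → s.star (idealK R K P) = idealK R K P →
          s.star (idealK R K P * idealK R K P) ≠ idealK R K P) ∧
        ∀ r : R, r ≠ 0 → {M : Ideal R | s.MaxIdeal M ∧ r ∈ M}.Finite) := by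
  constructor
  · rintro ⟨hic, hst⟩
    have hP : ∀ J : Submodule R K, J ≠ ⊥ → J.FG → s.star (J * (1 / J)) = 1 := fun J hJ hfg =>
      (hst J (IsFrac.of_fg hJ hfg)).star_mul_one_div_eq_one hft hinter (IsFrac.of_fg hJ hfg)
        (StarOperation.star_div_star_le_one_of_fg hft hinter hic hJ hfg)
    refine ⟨hP, fun P hPp hP0 hPs => (hst _ (IsFrac.idealK hP0)).star_mul_self_ne hft hinter
      hPp.ne_top hP0 hPs, fun r hr => StarOperation.finite_setOf_maxIdeal hft hinter hr
        (fun M hM hrM => ?_) hst⟩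
    have hM0 : M ≠ ⊥ := fun h => hr (by rw [h] at hrM; exact hrM)
    have hfr : IsFrac R K (idealK R K M) := IsFrac.idealK hM0
    exact (hst _ hfr).star_mul_one_div_eq_one hft hinter hfr
      (by rw [hM.2.1]; exact hM.div_self_le_one hft hinter hP hM0)
  · rintro ⟨hP, hsd, hfin⟩
    exact ⟨fun x hx => StarOperation.integral_mem_of_star_mul_one_div hft hinter hP hx,
      fun I hI => StarOperation.stable_of_strongly_discrete hft hinter hP hsd hfin hI⟩
end

section
/- Let R be an integral domain with quotient field K. Then the following are equivalent: (i) R is Clifford regular and the integral closure of R in K is a Dedekind domain; (ii) R is stable and R has dimension one, i.e. every nonzero prime ideal of R is maximal. -/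
open scoped Pointwise

section QuadraticExtension

variable {R O : Type*} [CommRing R] [CommRing O] [Algebra R O]

/-- In an extension where every module between `R` and `O` is a ring, at most three maximal ideals
of `O` lie over a given prime ideal of `R`. -/
theorem finite_maximal_over_of_quadratic
    (quad : ∀ a b : O, ∃ r s t : R, a * b = algebraMap R O r + s • a + t • b) (p : Ideal R) :
    {Q : Ideal O | Q.IsMaximal ∧ Q.comap (algebraMap R O) = p}.Finite := by
  by_contra hinf
  have : Infinite {Q : Ideal O | Q.IsMaximal ∧ Q.comap (algebraMap R O) = p} :=
    Set.infinite_coe_iff.mpr hinf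
  let e := Infinite.natEmbedding {Q : Ideal O | Q.IsMaximal ∧ Q.comap (algebraMap R O) = p}
  let Q : Fin 4 → Ideal O := fun i ↦ (e i : Ideal O)
  have hQ (i : Fin 4) : (Q i).IsMaximal := (e i).2.1
  have hQp (i : Fin 4) (r : R) : algebraMap R O r ∈ Q i ↔ r ∈ p := by
    rw [← (e i).2.2]; exact Iff.rfl
  have hcop : Pairwise (Function.onFun IsCoprime Q) := by
    intro i j hij
    refine Ideal.isCoprime_of_isMaximal fun h ↦ hij ?_
    have := e.injective (Subtype.ext h)
    exact Fin.ext this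
  obtain ⟨a, ha⟩ := Ideal.exists_forall_sub_mem_ideal hcop ![1, 1, 0, 0]
  obtain ⟨b, hb⟩ := Ideal.exists_forall_sub_mem_ideal hcop ![1, 0, 1, 0]
  obtain ⟨r, s, t, h⟩ := quad a b
  simp only [Algebra.smul_def] at h
  have key (i : Fin 4) (u v : O) (hu : a - u ∈ Q i) (hv : b - v ∈ Q i) :
      u * v - (algebraMap R O r + algebraMap R O s * u + algebraMap R O t * v) ∈ Q i := by
    have : u * v - (algebraMap R O r + algebraMap R O s * u + algebraMap R O t * v) =
        (algebraMap R O s - b) * (a - u) + (algebraMap R O t - u) * (b - v) := by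
      linear_combination h
    rw [this]
    exact add_mem (Ideal.mul_mem_left _ _ hu) (Ideal.mul_mem_left _ _ hv)
  have hr : r ∈ p := by
    have := key 3 0 0 (by simpa using ha 3) (by simpa using hb 3)
    rw [← hQp 3]; simpa using this
  have hs : s ∈ p := by
    have := key 1 1 0 (by simpa using ha 1) (by simpa using hb 1)
    have : algebraMap R O (r + s) ∈ Q 1 := by simpa [← sub_eq_add_neg] using neg_mem this
    simpa using sub_mem ((hQp 1 _).mp this) hr
  have ht : t ∈ p := by
    have := key 2 0 1 (by simpa using ha 2) (by simpa using hb 2)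
    have : algebraMap R O (r + t) ∈ Q 2 := by simpa [← sub_eq_add_neg] using neg_mem this
    simpa using sub_mem ((hQp 2 _).mp this) hr
  have h0 := key 0 1 1 (by simpa using ha 0) (by simpa using hb 0)
  have h1 : algebraMap R O (r + s + t) ∈ Q 0 := (hQp 0 _).mpr (add_mem (add_mem hr hs) ht)
  refine (hQ 0).ne_top ((Ideal.eq_top_iff_one _).mpr ?_)
  simpa using add_mem h0 h1

/-- If `O` has dimension at most one, is quadratic over `R`, and finitely generated ideals of `O`
divide the ideals they contain, then prime ideals of `O` are finitely generated, provided
the primes below them are maximal with finitely generated extension. -/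
theorem fg_of_quadratic [IsDomain O] [Ring.DimensionLEOne O]
    (quad : ∀ a b : O, ∃ r s t : R, a * b = algebraMap R O r + s • a + t • b)
    (hdvd : ∀ A B : Ideal O, B.FG → A ≤ B → ∃ D, A = B * D)
    (P : Ideal O) [hP : P.IsPrime] (hp : (P.comap (algebraMap R O)).IsMaximal)
    (hbot : (P.comap (algebraMap R O)).map (algebraMap R O) ≠ ⊥)
    (hfg : ((P.comap (algebraMap R O)).map (algebraMap R O)).FG) : P.FG := by
  classical
  set p := P.comap (algebraMap R O) with hpdef
  have hA0P : p.map (algebraMap R O) ≤ P := Ideal.map_comap_le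
  have lies (M : Ideal O) (hM : M.IsPrime) (h : p.map (algebraMap R O) ≤ M) :
      M.IsMaximal ∧ M.comap (algebraMap R O) = p :=
    ⟨hM.isMaximal fun h' ↦ hbot (le_bot_iff.mp (h'.symm ▸ h)),
      (hp.eq_of_le (hM.comap _).ne_top (Ideal.map_le_iff_le_comap.mp h)).symm⟩
  obtain ⟨y, hyP, hy⟩ : ∃ y ∈ P, ∀ Q : Ideal O, Q.IsMaximal ∧ Q.comap (algebraMap R O) = p →
      Q ≠ P → y ∉ Q := by
    have hfin := finite_maximal_over_of_quadratic quad p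
    have := hfin.to_subtype
    have hcop : Pairwise (Function.onFun IsCoprime
        fun Q : {Q : Ideal O | Q.IsMaximal ∧ Q.comap (algebraMap R O) = p} ↦ (Q : Ideal O)) := by
      intro Q Q' h
      have := Q.2.1
      have := Q'.2.1
      exact Ideal.isCoprime_of_isMaximal fun h' ↦ h (Subtype.ext h')
    obtain ⟨y, hy⟩ := Ideal.exists_forall_sub_mem_ideal hcop
      fun Q ↦ if (Q : Ideal O) = P then 0 else 1
    refine ⟨y, by simpa using hy ⟨P, lies P hP hA0P⟩, fun Q hQ hQP hyQ ↦ hQ.1.ne_top ?_⟩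
    rw [Ideal.eq_top_iff_one]
    have := hy ⟨Q, hQ⟩
    simp only [hQP, if_false] at this
    simpa using sub_mem hyQ this
  set A := p.map (algebraMap R O) ⊔ Ideal.span {y} with hA
  have hA0A : p.map (algebraMap R O) ≤ A := le_sup_left
  have hpA (r : R) (hr : r ∈ p) : algebraMap R O r ∈ A := hA0A (Ideal.mem_map_of_mem _ hr)
  have hAP : A ≤ P := sup_le hA0P ((Ideal.span_singleton_le_iff_mem _).mpr hyP)
  have hAfg : A.FG := Submodule.FG.sup hfg ⟨{y}, by simp⟩
  have uniq (M : Ideal O) (hM : M.IsPrime) (h : A ≤ M) : M = P := by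
    by_contra hne
    exact hy M (lies M hM (hA0A.trans h)) hne
      (h (Ideal.mem_sup_right (Ideal.mem_span_singleton_self y)))
  have cancel (x z : O) (hx : x ∉ P) (hxz : x * z ∈ A) : z ∈ A := by
    have htop : A ⊔ Ideal.span {x} = ⊤ := by
      by_contra h
      obtain ⟨M, hM, hle⟩ := Ideal.exists_le_maximal _ h
      have := uniq M hM.isPrime (le_sup_left.trans hle)
      exact hx (this ▸ hle (Ideal.mem_sup_right (Ideal.mem_span_singleton_self x)))
    obtain ⟨a, ha, w, hw, h1⟩ := Submodule.mem_sup.mp ((Ideal.eq_top_iff_one _).mp htop)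
    obtain ⟨c, rfl⟩ := Ideal.mem_span_singleton'.mp hw
    have : z = z * a + c * (x * z) := by linear_combination -z * h1
    rw [this]
    exact add_mem (Ideal.mul_mem_left _ _ ha) (Ideal.mul_mem_left _ _ hxz)
  have hmem (r : R) : algebraMap R O r ∈ P ↔ r ∈ p := Iff.rfl
  have sq (a : O) (ha : a ∈ P) : a * a ∈ A := by
    obtain ⟨r, s, t, h⟩ := quad a a
    simp only [Algebra.smul_def] at h
    have hr : r ∈ p := by
      rw [← hmem, show algebraMap R O r = (a - algebraMap R O s - algebraMap R O t) * a by
        linear_combination -h]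
      exact Ideal.mul_mem_left _ _ ha
    by_cases hc : s + t ∈ p
    · rw [show a * a = algebraMap R O r + a * algebraMap R O (s + t) by
        rw [map_add]; linear_combination h]
      exact add_mem (hpA r hr) (Ideal.mul_mem_left _ _ (hpA _ hc))
    · refine Ideal.mul_mem_left _ _ (cancel (a - algebraMap R O (s + t)) a (fun h' ↦ hc ?_) ?_)
      · rw [← hmem]
        simpa using sub_mem ha h'
      · rw [show (a - algebraMap R O (s + t)) * a = algebraMap R O r by
          rw [map_add]; linear_combination h]
        exact hpA r hr
  have mul (a b : O) (ha : a ∈ P) (hb : b ∈ P) : a * b ∈ A := by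
    obtain ⟨r, s, t, h⟩ := quad a b
    simp only [Algebra.smul_def] at h
    have hr : r ∈ p := by
      rw [← hmem, show algebraMap R O r = (b - algebraMap R O s) * a - algebraMap R O t * b by
        linear_combination -h]
      exact sub_mem (Ideal.mul_mem_left _ _ ha) (Ideal.mul_mem_left _ _ hb)
    by_cases hs : s ∈ p
    · by_cases ht : t ∈ p
      · rw [h]
        exact add_mem (add_mem (hpA r hr) (Ideal.mul_mem_right _ _ (hpA s hs)))
          (Ideal.mul_mem_right _ _ (hpA t ht))
      · refine cancel (algebraMap R O t) _ ht ?_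
        rw [show algebraMap R O t * (a * b) =
          (b - algebraMap R O s) * (a * a) - a * algebraMap R O r by linear_combination -a * h]
        exact sub_mem (Ideal.mul_mem_left _ _ (sq a ha)) (Ideal.mul_mem_left _ _ (hpA r hr))
    · refine cancel (algebraMap R O s) _ hs ?_
      rw [show algebraMap R O s * (a * b) =
        (a - algebraMap R O t) * (b * b) - b * algebraMap R O r by linear_combination -b * h]
      exact sub_mem (Ideal.mul_mem_left _ _ (sq b hb)) (Ideal.mul_mem_left _ _ (hpA r hr))
  have hPP : P * P ≤ A := Ideal.mul_le.mpr fun a ha b hb ↦ mul a b ha hb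
  have step (C : Ideal O) (hCfg : C.FG) (hAC : A ≤ C) (hCP : C ≤ P) (hne : C ≠ P) :
      ∃ B : Ideal O, B.FG ∧ C ≤ B ∧ B ≤ P ∧ C ≤ P * B := by
    obtain ⟨w, hwP, hwC⟩ := SetLike.exists_of_lt (lt_of_le_of_ne hCP hne)
    have hBfg : (C ⊔ Ideal.span {w}).FG := Submodule.FG.sup hCfg ⟨{w}, by simp⟩
    refine ⟨C ⊔ Ideal.span {w}, hBfg, le_sup_left,
      sup_le hCP ((Ideal.span_singleton_le_iff_mem _).mpr hwP), ?_⟩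
    obtain ⟨D, hD⟩ := hdvd C (C ⊔ Ideal.span {w}) hBfg le_sup_left
    have hDtop : D ≠ ⊤ := by
      rintro rfl
      rw [Ideal.mul_top] at hD
      exact hwC (hD ▸ Ideal.mem_sup_right (Ideal.mem_span_singleton_self w))
    obtain ⟨M, hM, hDM⟩ := Ideal.exists_le_maximal D hDtop
    have hCD : C ≤ D := hD.le.trans Ideal.mul_le_right
    have hMP := uniq M hM.isPrime (hAC.trans (hCD.trans hDM))
    calc C = (C ⊔ Ideal.span {w}) * D := hD
      _ ≤ (C ⊔ Ideal.span {w}) * P := Ideal.mul_mono_right (hMP ▸ hDM)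
      _ = P * (C ⊔ Ideal.span {w}) := mul_comm _ _
  by_contra hPfg
  have nefg (C : Ideal O) (hC : C.FG) : C ≠ P := fun h ↦ hPfg (h ▸ hC)
  obtain ⟨B, hBfg, hAB, hBP, h1⟩ := step A hAfg le_rfl hAP (nefg A hAfg)
  obtain ⟨B', hB'fg, hBB', hB'P, h2⟩ := step B hBfg hAB hBP (nefg B hBfg)
  have h3 : A ≤ B' * A := calc
    A ≤ P * (P * B') := h1.trans (Ideal.mul_mono_right h2)
    _ = B' * (P * P) := by ring
    _ ≤ B' * A := Ideal.mul_mono_right hPP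
  obtain ⟨r, hr, hrA⟩ :=
    Submodule.exists_sub_one_mem_and_smul_eq_zero_of_fg_of_le_smul B' A hAfg h3
  obtain ⟨x, hxA, hx0⟩ := Submodule.exists_mem_ne_zero_of_ne_bot
    fun h ↦ hbot (le_bot_iff.mp (hA0A.trans h.le))
  have hr0 : r = 0 := (mul_eq_zero.mp (hrA x hxA)).resolve_right hx0
  refine hP.ne_top ((Ideal.eq_top_iff_one _).mpr (hB'P ?_))
  simpa [hr0] using hr

end QuadraticExtension

section Domain

variable {R K : Type*} [CommRing R] [Field K] [Algebra R K]

/-- The ring of multipliers `(I : I)`. -/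
def multiplierRing (I : Submodule R K) : Subalgebra R K where
  carrier := {x | ∀ y ∈ I, x * y ∈ I}
  mul_mem' ha hb y hy := by rw [mul_assoc]; exact ha _ (hb y hy)
  add_mem' ha hb y hy := by rw [add_mul]; exact I.add_mem (ha y hy) (hb y hy)
  algebraMap_mem' r y hy := by rw [← Algebra.smul_def]; exact I.smul_mem r hy

theorem mem_multiplierRing {I : Submodule R K} {x : K} :
    x ∈ multiplierRing I ↔ ∀ y ∈ I, x * y ∈ I :=
  Iff.rfl

theorem mem_div_self_iff {I : Submodule R K} {x : K} : x ∈ I / I ↔ x ∈ multiplierRing I :=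
  Submodule.mem_div_iff_forall_mul_mem

/-- The ideal of the integral closure generated by the integral elements of a submodule. -/
def extendIdeal (M : Submodule R K) : Ideal (integralClosure R K) :=
  Ideal.span {x | (x : K) ∈ M}

theorem mem_extendIdeal {M : Submodule R K} {x : integralClosure R K} (hx : (x : K) ∈ M) :
    x ∈ extendIdeal M :=
  Ideal.subset_span hx

theorem exists_mem_extendIdeal_mul {M N : Submodule R K}
    (hM : M ≤ Subalgebra.toSubmodule (integralClosure R K))
    (hN : N ≤ Subalgebra.toSubmodule (integralClosure R K)) {z : K} (hz : z ∈ M * N) :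
    ∃ w ∈ extendIdeal M * extendIdeal N, (w : K) = z := by
  induction hz using Submodule.mul_induction_on' with
  | mem_mul_mem m hm n hn =>
    exact ⟨⟨m, hM hm⟩ * ⟨n, hN hn⟩,
      Ideal.mul_mem_mul (mem_extendIdeal hm) (mem_extendIdeal hn), rfl⟩
  | add x _ y _ hx hy =>
    obtain ⟨v, hv, rfl⟩ := hx
    obtain ⟨w, hw, rfl⟩ := hy
    exact ⟨v + w, add_mem hv hw, rfl⟩

/-- Lying over: a proper ideal `D` of an integral overring `E` stays proper in the
integral closure. -/
theorem one_mem_of_extendIdeal_eq_top (E : Subalgebra R K) (hE : E ≤ integralClosure R K)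
    (D : Submodule R K) (hDE : ∀ e ∈ E, ∀ x ∈ D, e * x ∈ D) (hD : D ≤ Subalgebra.toSubmodule E)
    (htop : extendIdeal D = ⊤) : (1 : K) ∈ D := by
  by_contra h1
  let D' : Ideal E :=
    { carrier := {x | (x : K) ∈ D}
      add_mem' := fun ha hb ↦ D.add_mem ha hb
      zero_mem' := D.zero_mem
      smul_mem' := fun e x hx ↦ hDE e e.2 x hx }
  have hD' : D' ≠ ⊤ := fun h ↦ h1 ((Ideal.eq_top_iff_one _).mp h)
  obtain ⟨m, hm, hle⟩ := Ideal.exists_le_maximal D' hD'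
  let _ : Algebra E (integralClosure R K) := (Subalgebra.inclusion hE).toRingHom.toAlgebra
  have : IsScalarTower R E (integralClosure R K) := IsScalarTower.of_algebraMap_eq fun _ ↦ rfl
  have : Algebra.IsIntegral E (integralClosure R K) := Algebra.IsIntegral.tower_top R
  have hinj : Function.Injective (algebraMap E (integralClosure R K)) :=
    Subalgebra.inclusion_injective hE
  obtain ⟨Q, hQ, hQm⟩ := Ideal.exists_ideal_over_maximal_of_isIntegral
    (S := integralClosure R K) m (by
      rw [(RingHom.injective_iff_ker_eq_bot _).mp hinj]; exact bot_le)
  refine hQ.ne_top (top_le_iff.mp (htop ▸ Ideal.span_le.mpr fun x hx ↦ ?_))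
  have : (⟨x, hD hx⟩ : E) ∈ Q.comap (algebraMap E (integralClosure R K)) := hQm ▸ hle hx
  exact this

theorem multiplierRing_le_of_fg {I : Submodule R K} (hI : I ≠ ⊥) (hfg : I.FG) :
    multiplierRing I ≤ integralClosure R K := fun x hx ↦ by
  refine isIntegral_of_smul_mem_submodule I hI hfg x fun n hn ↦ ?_
  exact mem_multiplierRing.mp hx n hn

theorem IsStableIdeal.one_mem {I : Submodule R K} (h : IsStableIdeal R K I) :
    (1 : K) ∈ I * ((I / I) / I) := by
  rw [h]; exact mem_div_self_iff.mpr (multiplierRing I).one_mem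

theorem mul_mem_multiplierRing {I : Submodule R K} {g x : K} (hg : g ∈ (I / I) / I) (hx : x ∈ I) :
    g * x ∈ multiplierRing I :=
  mem_div_self_iff.mp (Submodule.mem_div_iff_forall_mul_mem.mp hg x hx)

/-- A stable module between `R` and its integral closure is a ring. -/
theorem IsStableIdeal.mul_mem_of_one_mem {I : Submodule R K} (h : IsStableIdeal R K I)
    (hfg : I.FG) (h1 : (1 : K) ∈ I) (hle : I ≤ Subalgebra.toSubmodule (integralClosure R K))
    {a b : K} (ha : a ∈ I) (hb : b ∈ I) : a * b ∈ I := by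
  have hE : multiplierRing I ≤ integralClosure R K :=
    multiplierRing_le_of_fg (fun h0 ↦ one_ne_zero ((Submodule.mem_bot R).mp (h0 ▸ h1))) hfg
  have hD : (I / I) / I ≤ Subalgebra.toSubmodule (multiplierRing I) := fun g hg ↦ by
    simpa using mul_mem_multiplierRing hg h1
  have key : (1 : K) ∈ (I / I) / I := by
    refine one_mem_of_extendIdeal_eq_top (multiplierRing I) hE _ (fun e he x hx ↦ ?_) hD ?_
    · refine Submodule.mem_div_iff_forall_mul_mem.mpr fun y hy ↦ ?_
      rw [mul_assoc]
      exact mem_div_self_iff.mpr <| (multiplierRing I).mul_mem he (mul_mem_multiplierRing hx hy)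
    · obtain ⟨w, hw, hw1⟩ := exists_mem_extendIdeal_mul hle
        (fun _ hx ↦ hE (hD hx)) h.one_mem
      obtain rfl : w = 1 := Subtype.ext hw1
      exact (Ideal.eq_top_iff_one _).mpr (Ideal.mul_le_right hw)
  have := mul_mem_multiplierRing key ha
  rw [one_mul] at this
  exact mem_multiplierRing.mp this b hb

/-- An ideal of the integral closure that is generated by a stable ideal `I` with integral
multipliers is finitely generated and divides the ideals it contains. -/
theorem IsStableIdeal.fg_and_dvd {I : Submodule R K} (h : IsStableIdeal R K I)
    (hE : multiplierRing I ≤ integralClosure R K) {s : Set (integralClosure R K)}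
    (hs : ∀ x : K, x ∈ I → ∃ y ∈ Ideal.span s, (y : K) = x) (hsI : ∀ x ∈ s, (x : K) ∈ I) :
    (Ideal.span s).FG ∧ ∀ A ≤ Ideal.span s, ∃ D, A = Ideal.span s * D := by
  have integral (g : K) (hg : g ∈ (I / I) / I) (b : integralClosure R K) (hb : b ∈ Ideal.span s) :
      g * b ∈ integralClosure R K := by
    induction hb using Submodule.span_induction with
    | mem x hx => exact hE (mul_mem_multiplierRing hg (hsI x hx))
    | zero => simp
    | add x y _ _ hx hy => simpa [mul_add] using add_mem hx hy
    | smul c x _ hx => simpa [mul_left_comm] using mul_mem c.2 hx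
  constructor
  · have key (z : K) (hz : z ∈ I * ((I / I) / I)) : ∃ F ≤ Ideal.span s, F.FG ∧
        ∀ a ∈ Ideal.span s, ∃ w ∈ F, (w : K) = z * a := by
      induction hz using Submodule.mul_induction_on' with
      | mem_mul_mem m hm n hn =>
        obtain ⟨y, hy, rfl⟩ := hs m hm
        refine ⟨Ideal.span {y}, (Ideal.span_singleton_le_iff_mem _).mpr hy, ⟨{y}, by simp⟩,
          fun a ha ↦ ⟨y * ⟨_, integral n hn a ha⟩,
            Ideal.mul_mem_right _ _ (Ideal.mem_span_singleton_self y), by simp [mul_assoc]⟩⟩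
      | add x _ y _ hx hy =>
        obtain ⟨F, hF, hFfg, hFx⟩ := hx
        obtain ⟨F', hF', hF'fg, hFy⟩ := hy
        refine ⟨F ⊔ F', sup_le hF hF', Submodule.FG.sup hFfg hF'fg, fun a ha ↦ ?_⟩
        obtain ⟨v, hv, hv'⟩ := hFx a ha
        obtain ⟨w, hw, hw'⟩ := hFy a ha
        exact ⟨v + w, Submodule.add_mem_sup hv hw, by simp [hv', hw', add_mul]⟩
    obtain ⟨F, hF, hFfg, h1⟩ := key 1 h.one_mem
    convert hFfg
    refine le_antisymm (fun a ha ↦ ?_) hF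
    obtain ⟨w, hw, hwa⟩ := h1 a ha
    rw [one_mul] at hwa
    exact Subtype.ext hwa ▸ hw
  · intro A hA
    let D : Ideal (integralClosure R K) :=
      { carrier := {x | ∀ b ∈ Ideal.span s, x * b ∈ A}
        add_mem' := fun hx hy b hb ↦ by rw [add_mul]; exact add_mem (hx b hb) (hy b hb)
        zero_mem' := fun b _ ↦ by simp
        smul_mem' := fun c x hx b hb ↦ by
          rw [smul_eq_mul, mul_assoc]; exact Ideal.mul_mem_left _ _ (hx b hb) }
    have key (z : K) (hz : z ∈ I * ((I / I) / I)) :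
        ∀ a ∈ A, ∃ w ∈ Ideal.span s * D, (w : K) = z * a := by
      induction hz using Submodule.mul_induction_on' with
      | mem_mul_mem m hm n hn =>
        intro a ha
        obtain ⟨y, hy, rfl⟩ := hs m hm
        refine ⟨y * ⟨_, integral n hn a (hA ha)⟩, Ideal.mul_mem_mul hy fun b hb ↦ ?_,
          by simp [mul_assoc]⟩
        have : (⟨_, integral n hn a (hA ha)⟩ : integralClosure R K) * b =
            ⟨_, integral n hn b hb⟩ * a := Subtype.ext (by
          simp only [MulMemClass.coe_mul]; ring)
        rw [this]
        exact Ideal.mul_mem_left _ _ ha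
      | add x _ y _ hx hy =>
        intro a ha
        obtain ⟨v, hv, hv'⟩ := hx a ha
        obtain ⟨w, hw, hw'⟩ := hy a ha
        exact ⟨v + w, add_mem hv hw, by simp [hv', hw', add_mul]⟩
    refine ⟨D, le_antisymm (fun a ha ↦ ?_) (Ideal.mul_le.mpr fun b hb x hx ↦ ?_)⟩
    · obtain ⟨w, hw, hwa⟩ := key 1 h.one_mem a ha
      rw [one_mul] at hwa
      exact Subtype.ext hwa ▸ hw
    · rw [mul_comm]; exact hx b hb

theorem StableDomain.cliffordRegularDomain (h : StableDomain R K) : CliffordRegularDomain R K := by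
  intro I hI
  have hI2 : I = I * I * ((I / I) / I) := by
    rw [mul_assoc, h I hI]
    refine le_antisymm (fun x hx ↦ ?_) (Submodule.mul_le.mpr fun x hx e he ↦ ?_)
    · simpa using Submodule.mul_mem_mul hx (mem_div_self_iff.mpr (multiplierRing I).one_mem)
    · rw [mul_comm]
      exact Submodule.mem_div_iff_forall_mul_mem.mp he x hx
  exact ⟨_, fun h0 ↦ hI.1 (by rw [hI2, h0, Submodule.mul_bot]), hI2⟩

variable [IsDomain R] [IsFractionRing R K]

theorem isFrac_of_fg {I : Submodule R K} (hI : I ≠ ⊥) (hfg : I.FG) : IsFrac R K I := by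
  obtain ⟨d, hd, h⟩ := FractionalIdeal.isFractional_of_fg (S := nonZeroDivisors R) hfg
  refine ⟨hI, d, nonZeroDivisors.ne_zero hd, fun x hx ↦ ?_⟩
  obtain ⟨a, ha⟩ := h x hx
  exact ⟨a, by rw [ha, Algebra.smul_def]⟩

/-- The integral closure of a stable domain is a quadratic extension. -/
theorem StableDomain.quadratic (h : StableDomain R K) (a b : integralClosure R K) :
    ∃ r s t : R, a * b = algebraMap R _ r + s • a + t • b := by
  have h1 : (1 : K) ∈ Submodule.span R {1, (a : K), (b : K)} := Submodule.subset_span (by simp)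
  have hfg : (Submodule.span R {1, (a : K), (b : K)}).FG :=
    Submodule.fg_span (Set.toFinite _)
  have hne : Submodule.span R {1, (a : K), (b : K)} ≠ ⊥ :=
    fun h0 ↦ one_ne_zero ((Submodule.mem_bot R).mp (h0 ▸ h1))
  have := (h _ (isFrac_of_fg hne hfg)).mul_mem_of_one_mem hfg h1 (Submodule.span_le.mpr (by
      rintro x (rfl | rfl | rfl)
      exacts [(integralClosure R K).one_mem, a.2, b.2]))
    (a := a) (b := b) (Submodule.subset_span (by simp)) (Submodule.subset_span (by simp))
  obtain ⟨r, s, t, h⟩ := Submodule.mem_span_triple.mp this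
  refine ⟨r, s, t, Subtype.ext ?_⟩
  rw [MulMemClass.coe_mul, ← h]
  simp [Algebra.smul_def]

/-- The integral closure of a stable domain is a Prüfer domain. -/
theorem StableDomain.dvd_of_fg (h : StableDomain R K) (A B : Ideal (integralClosure R K))
    (hB : B.FG) (hAB : A ≤ B) : ∃ D, A = B * D := by
  rcases eq_or_ne B ⊥ with rfl | hne
  · exact ⟨⊥, by simpa using hAB⟩
  obtain ⟨s, rfl⟩ := hB
  have hfg : (Submodule.span R ((↑) '' (s : Set (integralClosure R K)) : Set K)).FG :=
    Submodule.fg_span (s.finite_toSet.image _)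
  have hI : Submodule.span R ((↑) '' (s : Set (integralClosure R K)) : Set K) ≠ ⊥ := by
    intro h0
    refine hne (Ideal.span_eq_bot.mpr fun x hx ↦ Subtype.ext ?_)
    exact Submodule.span_eq_bot.mp h0 _ ⟨x, hx, rfl⟩
  refine ((h _ (isFrac_of_fg hI hfg)).fg_and_dvd (multiplierRing_le_of_fg hI hfg)
    (fun x hx ↦ ?_) fun x hx ↦ Submodule.subset_span ⟨x, hx, rfl⟩).2 A hAB
  induction hx using Submodule.span_induction with
  | mem x hx =>
    obtain ⟨y, hy, rfl⟩ := hx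
    exact ⟨y, Ideal.subset_span hy, rfl⟩
  | zero => exact ⟨0, zero_mem _, rfl⟩
  | add x y _ _ hx hy =>
    obtain ⟨v, hv, rfl⟩ := hx
    obtain ⟨w, hw, rfl⟩ := hy
    exact ⟨v + w, add_mem hv hw, rfl⟩
  | smul c x _ hx =>
    obtain ⟨v, hv, rfl⟩ := hx
    exact ⟨c • v, Submodule.smul_of_tower_mem _ c hv, rfl⟩

end Domain

theorem exists_mul_pow_eq_mul_of_dimensionLEOne {A : Type*} [CommRing A] [Ring.DimensionLEOne A]
    (P : Ideal A) [hP : P.IsPrime] {b d : A} (hb : b ∈ P) (hd : d ≠ 0) :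
    ∃ s ∉ P, ∃ (k : ℕ) (e : A), s * b ^ k = d * e := by
  by_contra! hcon
  have hdisj : Disjoint (Ideal.span {d} : Set A) ↑(P.primeCompl ⊔ Submonoid.powers b) := by
    rw [Set.disjoint_left]
    intro x hx hx'
    obtain ⟨s, hs, _, ⟨k, rfl⟩, rfl⟩ := Submonoid.mem_sup.mp hx'
    obtain ⟨e, he⟩ := Ideal.mem_span_singleton.mp hx
    exact hcon s hs k e he
  obtain ⟨Q, hQ, hdQ, hQdisj⟩ := Ideal.exists_le_prime_disjoint _ _ hdisj
  have hQP : Q ≤ P := fun x hx ↦ by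
    by_contra hxP
    exact Set.disjoint_left.mp hQdisj hx
      (le_sup_left (a := P.primeCompl) (b := Submonoid.powers b) hxP)
  have hQmax : Q.IsMaximal := hQ.isMaximal fun h ↦
    hd ((Submodule.mem_bot A).mp (h ▸ hdQ (Ideal.mem_span_singleton_self d)))
  have hbQ : b ∈ Q := (hQmax.eq_of_le hP.ne_top hQP).symm ▸ hb
  exact Set.disjoint_left.mp hQdisj hbQ
    (le_sup_right (a := P.primeCompl) (b := Submonoid.powers b) (Submonoid.mem_powers b))

section OverField

variable {R K : Type*} [CommRing R] [IsDomain R] [Field K] [Algebra R K] [IsFractionRing R K]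

variable (R K) in
theorem isFractionRing_integralClosure : IsFractionRing (integralClosure R K) K :=
  have : Algebra.IsAlgebraic R K := IsLocalization.isAlgebraic K (nonZeroDivisors R)
  integralClosure.isFractionRing_of_algebraic
    fun _ hx ↦ (FaithfulSMul.algebraMap_eq_zero_iff R K).mp hx

/-- The integral closure of a one-dimensional stable domain is completely integrally closed. -/
theorem StableDomain.mem_integralClosure_of_forall_pow (h : StableDomain R K)
    [Ring.DimensionLEOne (integralClosure R K)] {y : K} {d : integralClosure R K} (hd : d ≠ 0)
    (hy : ∀ n, (d : K) * y ^ n ∈ integralClosure R K) : y ∈ integralClosure R K := by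
  have h1 : (1 : K) ∈ Submodule.span R {1, y} := Submodule.subset_span (by simp)
  have hyI : y ∈ Submodule.span R {1, y} := Submodule.subset_span (by simp)
  have hfg : (Submodule.span R {1, y}).FG := Submodule.fg_span (Set.toFinite _)
  have hne : Submodule.span R {1, y} ≠ ⊥ :=
    fun h0 ↦ one_ne_zero ((Submodule.mem_bot R).mp (h0 ▸ h1))
  have hE := multiplierRing_le_of_fg hne hfg
  have hmem := (h _ (isFrac_of_fg hne hfg)).one_mem
  set G := (Submodule.span R {1, y} / Submodule.span R {1, y}) / Submodule.span R {1, y}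
  rw [Submodule.span_insert, Submodule.sup_mul] at hmem
  obtain ⟨u, hu, v, hv, huv⟩ := Submodule.mem_sup.mp hmem
  obtain ⟨a, ha, rfl⟩ := Submodule.mem_span_singleton_mul.mp hu
  obtain ⟨b, hb, rfl⟩ := Submodule.mem_span_singleton_mul.mp hv
  have hG (g : K) (hg : g ∈ G) : g ∈ integralClosure R K ∧ g * y ∈ integralClosure R K :=
    ⟨by simpa using hE (mul_mem_multiplierRing hg h1), hE (mul_mem_multiplierRing hg hyI)⟩
  let C : Ideal (integralClosure R K) :=
    { carrier := {x | (x : K) * y ∈ integralClosure R K}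
      add_mem' := fun hx hz ↦ by simpa [add_mul] using add_mem hx hz
      zero_mem' := by simp
      smul_mem' := fun c x hx ↦ by simpa [mul_assoc] using mul_mem c.2 hx }
  by_cases hC : C = ⊤
  · simpa using (show ((1 : integralClosure R K) : K) * y ∈ integralClosure R K from
      (Ideal.eq_top_iff_one C).mp hC)
  exfalso
  obtain ⟨P, hP, hCP⟩ := Ideal.exists_le_maximal C hC
  have hPprime := hP.isPrime
  obtain ⟨a, rfl⟩ : ∃ a' : integralClosure R K, (a' : K) = a := ⟨⟨a, (hG a ha).1⟩, rfl⟩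
  obtain ⟨b, rfl⟩ : ∃ b' : integralClosure R K, (b' : K) = b := ⟨⟨b, (hG b hb).1⟩, rfl⟩
  have haP : a ∈ P := hCP (hG a ha).2
  have hbP : b ∈ P := hCP (hG b hb).2
  let w : integralClosure R K := ⟨b * y, (hG b hb).2⟩
  have hw : a + w = 1 := Subtype.ext (by simpa [w, mul_comm] using huv)
  have hwP : w ∉ P := fun hwP ↦ hP.ne_top ((Ideal.eq_top_iff_one P).mpr (hw ▸ add_mem haP hwP))
  obtain ⟨s, hs, k, e, hse⟩ := exists_mul_pow_eq_mul_of_dimensionLEOne P hbP hd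
  let c : integralClosure R K := ⟨_, hy (k + 1)⟩
  have hc : d * w ^ (k + 1) = c * b ^ (k + 1) := Subtype.ext (by simp [c, w]; ring)
  have hfin : s * w ^ (k + 1) = c * e * b := mul_left_cancel₀ hd (by
    linear_combination s * hc + c * b * hse)
  exact (hPprime.mul_notMem hs fun h' ↦ hwP (hPprime.mem_of_pow_mem _ h'))
    (hfin ▸ Ideal.mul_mem_left _ _ hbP)

theorem StableDomain.multiplierRing_le (h : StableDomain R K)
    [Ring.DimensionLEOne (integralClosure R K)] {I : Submodule R K} (hI : IsFrac R K I) :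
    multiplierRing I ≤ integralClosure R K := by
  obtain ⟨hne, d, hd, hdI⟩ := hI
  obtain ⟨i, hi, hi0⟩ := Submodule.exists_mem_ne_zero_of_ne_bot hne
  intro y hy
  have hpow (n : ℕ) : algebraMap R K d * i * y ^ n ∈ integralClosure R K := by
    obtain ⟨r, hr⟩ := hdI _ (mem_multiplierRing.mp (pow_mem hy n) i hi)
    rw [mul_assoc, mul_comm i, hr]
    exact (integralClosure R K).algebraMap_mem r
  refine h.mem_integralClosure_of_forall_pow
    (d := ⟨algebraMap R K d * i, by simpa using hpow 0⟩) (fun h0 ↦ ?_) hpow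
  have : algebraMap R K d * i = 0 := congrArg Subtype.val h0
  rw [mul_eq_zero, FaithfulSMul.algebraMap_eq_zero_iff] at this
  exact this.elim hd hi0

theorem StableDomain.isDedekindDomain_integralClosure (h : StableDomain R K)
    [Ring.DimensionLEOne R] : IsDedekindDomain (integralClosure R K) := by
  have hinj : Function.Injective (algebraMap R (integralClosure R K)) :=
    FaithfulSMul.algebraMap_injective R _
  have hnoeth : IsNoetherianRing (integralClosure R K) := by
    refine IsNoetherianRing.of_prime_ne_bot fun P hP hPne ↦ ?_
    have hp0 : P.comap (algebraMap R (integralClosure R K)) ≠ ⊥ :=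
      Ideal.IsIntegral.comap_ne_bot R hPne
    have hI : IsFrac R K (idealK R K (P.comap (algebraMap R (integralClosure R K)))) := by
      refine ⟨fun h0 ↦ hp0 ?_, 1, one_ne_zero, ?_⟩
      · refine (Submodule.eq_bot_iff _).mpr fun r hr ↦ ?_
        have : algebraMap R K r ∈ idealK R K (P.comap (algebraMap R (integralClosure R K))) :=
          ⟨r, hr, rfl⟩
        rwa [h0, Submodule.mem_bot, FaithfulSMul.algebraMap_eq_zero_iff] at this
      · rintro _ ⟨r, -, rfl⟩
        exact ⟨r, by simp⟩
    refine fg_of_quadratic h.quadratic h.dvd_of_fg P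
      ((hP.comap _).isMaximal hp0) (fun h0 ↦ hp0 ((Ideal.map_eq_bot_iff_of_injective hinj).mp h0))
      ((h _ hI).fg_and_dvd (h.multiplierRing_le hI) ?_ ?_).1
    · rintro _ ⟨r, hr, rfl⟩
      exact ⟨_, Ideal.mem_map_of_mem _ hr, rfl⟩
    · rintro _ ⟨r, hr, rfl⟩
      exact ⟨r, hr, rfl⟩
  have hint : IsIntegrallyClosed (integralClosure R K) := by
    have := isFractionRing_integralClosure R K
    exact (IsIntegrallyClosed.integralClosure_eq_bot_iff K).mp integralClosure_idem
  have : IsDedekindRing (integralClosure R K) :=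
    { hnoeth, hint with maximalOfPrime := Ring.DimensionLEOne.maximalOfPrime }
  exact {}

theorem multiplierRing_le_of_isNoetherianRing [IsNoetherianRing (integralClosure R K)]
    {I : Submodule R K} (hI : IsFrac R K I) : multiplierRing I ≤ integralClosure R K := by
  obtain ⟨hne, d, hd, hdI⟩ := hI
  have := isFractionRing_integralClosure R K
  obtain ⟨i, hi, hi0⟩ := Submodule.exists_mem_ne_zero_of_ne_bot hne
  let N : Submodule (integralClosure R K) K := Submodule.span _ (I : Set K)
  have hN : IsFractional (nonZeroDivisors (integralClosure R K)) N := by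
    refine ⟨algebraMap R _ d, mem_nonZeroDivisors_of_ne_zero ?_, fun b hb ↦ ?_⟩
    · rwa [Ne, FaithfulSMul.algebraMap_eq_zero_iff]
    · induction hb using Submodule.span_induction with
      | mem x hx =>
        obtain ⟨a, ha⟩ := hdI x hx
        refine ⟨algebraMap R _ a, ?_⟩
        rw [Algebra.smul_def]
        exact ha.symm
      | zero => simpa using IsLocalization.isInteger_zero
      | add x y _ _ hx hy => rw [smul_add]; exact IsLocalization.isInteger_add hx hy
      | smul c x _ hx => rw [smul_comm]; exact IsLocalization.isInteger_smul hx
  have hfg : N.FG := FractionalIdeal.fg_of_isNoetherianRing le_rfl ⟨N, hN⟩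
  intro y hy
  have hyint : IsIntegral (integralClosure R K) y := by
    refine isIntegral_of_smul_mem_submodule N
      (fun h0 ↦ hi0 (Submodule.span_eq_bot.mp h0 i hi)) hfg y fun n hn ↦ ?_
    induction hn using Submodule.span_induction with
    | mem x hx => exact Submodule.subset_span (mem_multiplierRing.mp hy x hx)
    | zero => simp
    | add x z _ _ hx hz => rw [smul_add]; exact add_mem hx hz
    | smul c x _ hx => rw [smul_comm]; exact N.smul_mem c hx
  exact isIntegral_trans y hyint

theorem CliffordRegularDomain.stableDomain (h : CliffordRegularDomain R K)
    [IsNoetherianRing (integralClosure R K)] : StableDomain R K := by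
  intro I hI
  have hE := multiplierRing_le_of_isNoetherianRing hI
  obtain ⟨J, -, hJ⟩ := h I hI
  set G := (I / I) / I with hG
  have hTE : I * G ≤ I / I := Submodule.mul_le.mpr fun x hx g hg ↦ by
    rw [mul_comm]
    exact Submodule.mem_div_iff_forall_mul_mem.mp hg x hx
  have hEI : (I / I) * I ≤ I :=
    Submodule.mul_le.mpr fun e he x hx ↦ Submodule.mem_div_iff_forall_mul_mem.mp he x hx
  have hJG : J ≤ G := Submodule.le_div_iff_mul_le.mpr <| Submodule.le_div_iff_mul_le.mpr <|
    le_of_eq (by rw [mul_assoc, mul_comm, ← hJ])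
  have hTI : I * G * I = I := le_antisymm
    ((mul_le_mul_left hTE I).trans hEI) (calc
      I = I * J * I := by rw [mul_right_comm]; exact hJ
      _ ≤ I * G * I := by gcongr)
  have hTT : I * G * (I * G) = I * G := by rw [← mul_assoc, hTI]
  have hTO : I * G ≤ Subalgebra.toSubmodule (integralClosure R K) :=
    fun x hx ↦ hE (mem_div_self_iff.mp (hTE hx))
  have hT0 : I * G ≠ ⊥ := fun h0 ↦ hI.1 (by rw [← hTI, h0, Submodule.bot_mul])
  have hidem : IsIdempotentElem (extendIdeal (I * G)) := by
    refine le_antisymm Ideal.mul_le_left (Ideal.span_le.mpr fun x hx ↦ ?_)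
    obtain ⟨w, hw, hwx⟩ := exists_mem_extendIdeal_mul hTO hTO (hTT.symm ▸ hx)
    exact Subtype.ext hwx ▸ hw
  have htop : extendIdeal (I * G) = ⊤ := by
    refine ((Ideal.isIdempotentElem_iff_eq_bot_or_top _
      (Ideal.fg_of_isNoetherianRing _)).mp hidem).resolve_left fun h0 ↦ ?_
    obtain ⟨t, ht, ht0⟩ := Submodule.exists_mem_ne_zero_of_ne_bot hT0
    have := mem_extendIdeal (x := ⟨t, hTO ht⟩) ht
    rw [h0, Ideal.mem_bot] at this
    exact ht0 (congrArg Subtype.val this)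
  have hET (e : K) (he : e ∈ multiplierRing I) (x : K) (hx : x ∈ I * G) : e * x ∈ I * G := by
    have : e * x ∈ (I / I) * I * G := by
      rw [mul_assoc]; exact Submodule.mul_mem_mul (mem_div_self_iff.mpr he) hx
    exact mul_le_mul_left hEI G this
  have h1 := one_mem_of_extendIdeal_eq_top (multiplierRing I) hE (I * G) hET
    (fun x hx ↦ mem_div_self_iff.mp (hTE hx)) htop
  refine le_antisymm hTE fun e he ↦ ?_
  simpa using hET e (mem_div_self_iff.mp he) 1 h1

end OverField

/-- `R` is Clifford regular with Dedekind integral closure if and only if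
`R` is a stable domain of dimension one. -/
theorem clifford_regular_dedekind_closure_iff_stable_dim_one
    {R K : Type*} [CommRing R] [IsDomain R] [Field K] [Algebra R K] [IsFractionRing R K] :
    (CliffordRegularDomain R K ∧ IsDedekindDomain (integralClosure R K)) ↔
      (StableDomain R K ∧ ∀ P : Ideal R, P.IsPrime → P ≠ ⊥ → P.IsMaximal) := by
  constructor
  · rintro ⟨h, hD⟩
    refine ⟨h.stableDomain, fun P hP hPne ↦ ?_⟩
    obtain ⟨Q, -, hQ, rfl⟩ := Ideal.exists_ideal_over_prime_of_isIntegral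
      (S := integralClosure R K) P ⊥ (by
        rw [← RingHom.ker_eq_comap_bot, (RingHom.injective_iff_ker_eq_bot _).mp
          (FaithfulSMul.algebraMap_injective R (integralClosure R K))]
        exact bot_le)
    have hQmax : Q.IsMaximal := hQ.isMaximal fun h0 ↦ hPne (by
      rw [h0, ← RingHom.ker_eq_comap_bot, (RingHom.injective_iff_ker_eq_bot _).mp
        (FaithfulSMul.algebraMap_injective R (integralClosure R K))])
    exact Ideal.isMaximal_comap_of_isIntegral_of_isMaximal Q
  · rintro ⟨h, hdim⟩
    have : Ring.DimensionLEOne R := ⟨fun hne hP ↦ hdim _ hP hne⟩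
    exact ⟨h.cliffordRegularDomain, h.isDedekindDomain_integralClosure⟩
end
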